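/- arXiv:2507.12354 — 2 statements merged into one kernel-verified Lean document; each statement's English description precedes it below -/
import Mathlib

section
/- The ℓ2-norm Turán density of the Fano plane equals 5/16; that is, the sequence ex_{ℓ2}(n, 𝔽)/n⁴ converges to 5/16 as n → ∞. -/
/-- A 3-graph: every edge is a 3-element subset of the vertex set `Fin n`. -/
def Is3Graph {n : ℕ} (H : Finset (Finset (Fin n))) : Prop := ∀ e ∈ H, e.card = 3

/-- The shadow of a 3-graph: the pairs contained in at least one edge. -/
def shadow3 {n : ℕ} (H : Finset (Finset (Fin n))) : Finset (Finset (Fin n)) :=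
  Finset.univ.filter fun e => e.card = 2 ∧ ∃ E ∈ H, e ⊆ E

/-- The codegree of a pair `e`: the number of vertices `v` with `e ∪ {v} ∈ H`. -/
def codeg3 {n : ℕ} (H : Finset (Finset (Fin n))) (e : Finset (Fin n)) : ℕ :=
  (Finset.univ.filter fun v => v ∉ e ∧ insert v e ∈ H).card

/-- The ℓ2-norm of a 3-graph: `‖H‖₂ = ∑_{e ∈ ∂H} d_H(e)²`. -/
def l2norm {n : ℕ} (H : Finset (Finset (Fin n))) : ℕ :=
  ∑ e ∈ shadow3 H, (codeg3 H e) ^ 2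

/-- `H − v`: delete the vertex `v` and all edges containing it. -/
def delVert {n : ℕ} (H : Finset (Finset (Fin n))) (v : Fin n) : Finset (Finset (Fin n)) :=
  H.filter fun e => v ∉ e

/-- The ℓ2-norm degree of a vertex: `d_{2,H}(v) = ‖H‖₂ − ‖H − v‖₂`. -/
noncomputable def d2deg {n : ℕ} (H : Finset (Finset (Fin n))) (v : Fin n) : ℝ :=
  (l2norm H : ℝ) - (l2norm (delVert H v) : ℝ)
/-- The edges of the Fano plane, as a 3-graph on `Fin 7` (0-indexed version of
the edge set {123, 345, 561, 174, 275, 376, 246}). -/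
def fanoEdges : Finset (Finset (Fin 7)) :=
  {({0, 1, 2} : Finset (Fin 7)), {2, 3, 4}, {4, 5, 0}, {0, 6, 3}, {1, 6, 4}, {2, 6, 5}, {1, 3, 5}}

/-- A 3-graph is 𝔽-free if it contains no subgraph isomorphic to the Fano plane. -/
def FanoFree {n : ℕ} (H : Finset (Finset (Fin n))) : Prop :=
  ¬ ∃ f : Fin 7 → Fin n, Function.Injective f ∧ ∀ e ∈ fanoEdges, e.image f ∈ H
/-- `ex_{ℓ2}(n, 𝔽)`: the maximum ℓ2-norm over all 𝔽-free 3-graphs on `n` vertices. -/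
noncomputable def exL2 (n : ℕ) : ℕ :=
  sSup {m : ℕ | ∃ H : Finset (Finset (Fin n)), Is3Graph H ∧ FanoFree H ∧ l2norm H = m}

section FanoDensity

open Finset

/-- Three label sets admit no system of distinct representatives. -/
def NoSDR (X Y Z : Finset (Fin 4)) : Prop :=
  ∀ i ∈ X, ∀ j ∈ Y, ∀ l ∈ Z, i = j ∨ i = l ∨ j = l

/-- Hall's theorem for three label sets. -/
lemma NoSDR.hall {X Y Z : Finset (Fin 4)} (h : NoSDR X Y Z) :
    #X = 0 ∨ #Y = 0 ∨ #Z = 0 ∨ #(X ∪ Y) ≤ 1 ∨ #(X ∪ Z) ≤ 1 ∨ #(Y ∪ Z) ≤ 1 ∨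
      #(X ∪ Y ∪ Z) ≤ 2 := by
  by_contra! hc
  obtain ⟨hX, hY, hZ, hXY, hXZ, hYZ, hXYZ⟩ := hc
  obtain ⟨f, hf, hft⟩ := (Finset.all_card_le_biUnion_card_iff_exists_injective ![X, Y, Z]).1 <| by
    intro s
    have hs : s = ∅ ∨ s = {0} ∨ s = {1} ∨ s = {2} ∨ s = {0, 1} ∨ s = {0, 2} ∨ s = {1, 2} ∨
        s = {0, 1, 2} := by
      revert s
      decide
    rcases hs with rfl | rfl | rfl | rfl | rfl | rfl | rfl | rfl <;>
      simp [Finset.biUnion_insert, ← Finset.union_assoc, ← Finset.card_pos] <;> omega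
  have h01 := hf.ne (show (0 : Fin 3) ≠ 1 by decide)
  have h02 := hf.ne (show (0 : Fin 3) ≠ 2 by decide)
  have h12 := hf.ne (show (1 : Fin 3) ≠ 2 by decide)
  have := h (f 0) (hft 0) (f 1) (hft 1) (f 2) (hft 2)
  tauto

lemma card_add_card_le_inter (X Y : Finset (Fin 4)) : #X + #Y ≤ #(X ∩ Y) + 4 := by
  have h1 := card_union_add_card_inter X Y
  have h2 := card_le_univ (X ∪ Y)
  simp only [Fintype.card_fin] at h2
  omega

lemma card_label_le (X : Finset (Fin 4)) : #X ≤ 4 := by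
  simpa using card_le_univ X

/-- `NoSDR.hall` with the unions replaced by the cardinalities they bound. -/
lemma NoSDR.card {X Y Z : Finset (Fin 4)} (h : NoSDR X Y Z) :
    #X = 0 ∨ #Y = 0 ∨ #Z = 0 ∨ (#X ≤ 1 ∧ #Y ≤ 1) ∨ (#X ≤ 1 ∧ #Z ≤ 1) ∨
      (#Y ≤ 1 ∧ #Z ≤ 1) ∨ (#X ≤ 2 ∧ #Y ≤ 2 ∧ #Z ≤ 2) := by
  have hX : #X ≤ #(X ∪ Y ∪ Z) := card_le_card fun i hi => by simp [hi]
  have hY : #Y ≤ #(X ∪ Y ∪ Z) := card_le_card fun i hi => by simp [hi]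
  have hZ : #Z ≤ #(X ∪ Y ∪ Z) := card_le_card fun i hi => by simp [hi]
  have h1 : #X ≤ #(X ∪ Y) := card_le_card subset_union_left
  have h2 : #Y ≤ #(X ∪ Y) := card_le_card subset_union_right
  have h3 : #X ≤ #(X ∪ Z) := card_le_card subset_union_left
  have h4 : #Z ≤ #(X ∪ Z) := card_le_card subset_union_right
  have h5 : #Y ≤ #(Y ∪ Z) := card_le_card subset_union_left
  have h6 : #Z ≤ #(Y ∪ Z) := card_le_card subset_union_right
  rcases h.hall with h | h | h | h | h | h | h <;> omega

lemma star_le_nine {ab ac bc A B C : Finset (Fin 4)} (hab : 3 ≤ #ab) (hac : 3 ≤ #ac)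
    (hbc : 3 ≤ #bc) (h : NoSDR (ab ∩ C) (ac ∩ B) (bc ∩ A)) : #A + #B + #C ≤ 9 := by
  have := h.card
  have := card_add_card_le_inter ab C
  have := card_add_card_le_inter ac B
  have := card_add_card_le_inter bc A
  have := card_label_le A
  have := card_label_le B
  have := card_label_le C
  omega

lemma star_pair_le_of_full {A B C A' B' C' s : Finset (Fin 4)}
    (h : NoSDR C B A) (h' : NoSDR C' B' A')
    (hab : NoSDR s (A ∩ B') (A' ∩ B)) (hac : NoSDR s (A ∩ C') (A' ∩ C))
    (hbc : NoSDR s (B ∩ C') (B' ∩ C)) :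
    (#A + #B + #C) + (#A' + #B' + #C') +
      2 * (#(A ∩ A' ∩ s) + #(B ∩ B' ∩ s) + #(C ∩ C' ∩ s)) ≤ 24 := by
  have key : ∀ X X' : Finset (Fin 4), #(X ∩ X' ∩ s) ≤ #X ∧ #(X ∩ X' ∩ s) ≤ #X' ∧
      #(X ∩ X' ∩ s) ≤ #s := fun X X' =>
    ⟨card_le_card fun i hi => by simp at hi; tauto, card_le_card fun i hi => by simp at hi; tauto,
      card_le_card fun i hi => by simp at hi; tauto⟩
  have := key A A'
  have := key B B'
  have := key C C'
  have := card_label_le A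
  have := card_label_le B
  have := card_label_le C
  have := card_label_le A'
  have := card_label_le B'
  have := card_label_le C'
  have := card_add_card_le_inter A B'
  have := card_add_card_le_inter A' B
  have := card_add_card_le_inter A C'
  have := card_add_card_le_inter A' C
  have := card_add_card_le_inter B C'
  have := card_add_card_le_inter B' C
  rcases h.card with hd | hd | hd | hd | hd | hd | hd <;>
    rcases h'.card with hd' | hd' | hd' | hd' | hd' | hd' | hd' <;>
    first
      | omega
      | (have := hab.card; omega)
      | (have := hac.card; omega)
      | (have := hbc.card; omega)

lemma NoSDR.subset_of_pair {X Y Z I : Finset (Fin 4)} (h : NoSDR X Y Z) (hI : #I = 2)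
    (hIX : I ⊆ X) :
    #Y = 0 ∨ #Z = 0 ∨ (#Y ≤ 1 ∧ #Z ≤ 1) ∨ (X ⊆ I ∧ Y ⊆ I ∧ Z ⊆ I) := by
  have hX : #I ≤ #X := card_le_card hIX
  have hXY : #X ≤ #(X ∪ Y) := card_le_card subset_union_left
  have hXZ : #X ≤ #(X ∪ Z) := card_le_card subset_union_left
  have hY : #Y ≤ #(Y ∪ Z) := card_le_card subset_union_left
  have hZ : #Z ≤ #(Y ∪ Z) := card_le_card subset_union_right
  rcases h.hall with h | h | h | h | h | h | h
  iterate 6 omega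
  have hU : I = X ∪ Y ∪ Z := by
    refine eq_of_subset_of_card_le (fun i hi => ?_) (by omega)
    simp [hIX hi]
  right; right; right
  refine ⟨fun i hi => ?_, fun i hi => ?_, fun i hi => ?_⟩ <;> rw [hU] <;> simp [hi]

lemma star_pair_le_of_common_eq {ab ac bc A B C A' B' C' s K : Finset (Fin 4)}
    (hK : #K = 3) (hab : K ⊆ ab) (hac : K ⊆ ac) (hbc : K ⊆ bc)
    (hA : K ⊆ A) (hA' : K ⊆ A') (hs : K ⊆ s)
    (h : NoSDR (ab ∩ C) (ac ∩ B) (A ∩ bc)) (h' : NoSDR (ab ∩ C') (ac ∩ B') (A' ∩ bc))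
    (hQab : NoSDR (ab ∩ s) (A ∩ B') (A' ∩ B)) (hQac : NoSDR (ac ∩ s) (A ∩ C') (A' ∩ C)) :
    (#A + #B + #C) + (#A' + #B' + #C') ≤ 16 := by
  have key : ∀ X Y : Finset (Fin 4), K ⊆ X → #(Y ∩ K) ≤ #(X ∩ Y) := fun X Y hX =>
    card_le_card fun i hi => by
      rw [mem_inter] at hi ⊢
      exact ⟨hX hi.2, hi.1⟩
  have split : ∀ X : Finset (Fin 4), #X ≤ #(X ∩ K) + 1 := fun X => by
    have := card_add_card_le_inter X K
    omega
  have hsub : ∀ X Y : Finset (Fin 4), K ⊆ X → K ⊆ Y → 3 ≤ #(X ∩ Y) := fun X Y hX hY =>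
    hK ▸ card_le_card (subset_inter hX hY)
  have h1 := h.card
  have h1' := h'.card
  have h2 := hQab.card
  have h3 := hQac.card
  have := hsub _ _ hA hbc
  have := hsub _ _ hA' hbc
  have := hsub _ _ hab hs
  have := hsub _ _ hac hs
  have := key ab C hab
  have := key ac B hac
  have := key ab C' hab
  have := key ac B' hac
  have := key A B' hA
  have := key A' B hA'
  have := key A C' hA
  have := key A' C hA'
  have := card_add_card_le_inter A B'
  have := card_add_card_le_inter A' B
  have := card_add_card_le_inter A C'
  have := card_add_card_le_inter A' C
  have := split B
  have := split C
  have := split B'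
  have := split C'
  have := card_label_le A
  have := card_label_le A'
  have := card_label_le B
  have := card_label_le B'
  have := card_label_le C
  have := card_label_le C'
  clear h h' hQab hQac key split hsub
  rcases h1 with h1 | h1 | h1 | h1 | h1 | h1 | h1 <;> omega

lemma star_pair_le_of_common_ne {ab ac bc A B C A' B' C' s I J L : Finset (Fin 4)}
    (hI : #I = 2) (hJ : #J = 1) (hL : #L = 1)
    (hIJ : Disjoint I J) (hIL : Disjoint I L) (hJL : Disjoint J L)
    (hab : I ∪ J ⊆ ab) (hac : I ∪ J ⊆ ac) (hbc : I ∪ J ⊆ bc)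
    (hA : I ∪ L ⊆ A) (hA' : I ∪ L ⊆ A') (hs : I ∪ L ⊆ s)
    (h : NoSDR (ab ∩ C) (ac ∩ B) (A ∩ bc)) (h' : NoSDR (ab ∩ C') (ac ∩ B') (A' ∩ bc))
    (hQab : NoSDR (ab ∩ s) (A ∩ B') (A' ∩ B)) (hQac : NoSDR (ac ∩ s) (A ∩ C') (A' ∩ C)) :
    (#A + #B + #C) + (#A' + #B' + #C') ≤ 16 := by
  have hU : I ∪ J ∪ L = univ := by
    rw [← card_eq_iff_eq_univ, card_union_of_disjoint (disjoint_union_left.2 ⟨hIL, hJL⟩),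
      card_union_of_disjoint hIJ, hI, hJ, hL, Fintype.card_fin]
  have hdec : ∀ X : Finset (Fin 4), #X = #(X ∩ I) + #(X ∩ J) + #(X ∩ L) := fun X => by
    rw [← card_union_of_disjoint (hIJ.mono inter_subset_right inter_subset_right),
      ← card_union_of_disjoint (disjoint_union_left.2
        ⟨hIL.mono inter_subset_right inter_subset_right,
          hJL.mono inter_subset_right inter_subset_right⟩),
      ← inter_union_distrib_left, ← inter_union_distrib_left, hU, inter_univ]
  have hbd : ∀ X Y : Finset (Fin 4), #(X ∩ Y) ≤ #Y := fun X Y => card_le_card inter_subset_right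
  have hsubI : ∀ X : Finset (Fin 4), X ⊆ I → #(X ∩ J) = 0 ∧ #(X ∩ L) = 0 := fun X hX =>
    ⟨card_eq_zero.2 (disjoint_iff_inter_eq_empty.1 (hIJ.mono_left hX)),
      card_eq_zero.2 (disjoint_iff_inter_eq_empty.1 (hIL.mono_left hX))⟩
  have hle : ∀ X Y W : Finset (Fin 4), W ⊆ X → #(Y ∩ W) ≤ #((X ∩ Y) ∩ W) := fun X Y W hX =>
    card_le_card fun i hi => by
      simp only [mem_inter] at hi ⊢
      exact ⟨⟨hX hi.2, hi.1⟩, hi.2⟩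
  have hone : ∀ X Y : Finset (Fin 4), #(X ∩ J) + #(Y ∩ J) ≤ #((X ∩ Y) ∩ J) + 1 := fun X Y => by
    have h1 := card_union_add_card_inter (X ∩ J) (Y ∩ J)
    have h2 : #(X ∩ J ∪ Y ∩ J) ≤ #J :=
      card_le_card (union_subset inter_subset_right inter_subset_right)
    rw [← inter_inter_distrib_right] at h1
    omega
  obtain ⟨hIab, hJab⟩ := union_subset_iff.1 hab
  obtain ⟨hIac, hJac⟩ := union_subset_iff.1 hac
  obtain ⟨hIbc, hJbc⟩ := union_subset_iff.1 hbc
  obtain ⟨hIA, hLA⟩ := union_subset_iff.1 hA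
  obtain ⟨hIA', hLA'⟩ := union_subset_iff.1 hA'
  obtain ⟨hIs, hLs⟩ := union_subset_iff.1 hs
  have tri : ∀ A B C : Finset (Fin 4), I ⊆ A → NoSDR (ab ∩ C) (ac ∩ B) (A ∩ bc) →
      (#(C ∩ I) + #(C ∩ J) = 0 ∨ #(B ∩ I) + #(B ∩ J) = 0 ∨
        (#(C ∩ I) + #(C ∩ J) ≤ 1 ∧ #(B ∩ I) + #(B ∩ J) ≤ 1) ∨
        (#(A ∩ J) = 0 ∧ #(B ∩ J) = 0 ∧ #(C ∩ J) = 0)) := fun A B C hIA h => by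
    have h' : NoSDR (A ∩ bc) (ab ∩ C) (ac ∩ B) := fun i hi j hj l hl => by
      have := h j hj l hl i hi
      grind
    have := hdec (ab ∩ C)
    have := hdec (ac ∩ B)
    have := hle ab C I hIab
    have := hle ab C J hJab
    have := hle ac B I hIac
    have := hle ac B J hJac
    have h3 := hle bc A J hJbc
    rw [inter_comm bc A] at h3
    rcases h'.subset_of_pair hI (subset_inter hIA hIbc) with h0 | h0 | h0 | ⟨hX, hY, hZ⟩
    · omega
    · omega
    · omega
    · have := hsubI _ hX
      have := hsubI _ hY
      have := hsubI _ hZ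
      omega
  have quad : ∀ ab B B' : Finset (Fin 4), I ⊆ ab → NoSDR (ab ∩ s) (A ∩ B') (A' ∩ B) →
      ((#(B' ∩ I) + #(B' ∩ L) = 0 ∧ #(A ∩ J) + #(B' ∩ J) ≤ 1) ∨
        (#(B ∩ I) + #(B ∩ L) = 0 ∧ #(A' ∩ J) + #(B ∩ J) ≤ 1) ∨
        (#(B ∩ I) + #(B ∩ L) ≤ 1 ∧ #(B' ∩ I) + #(B' ∩ L) ≤ 1) ∨
        (#(B ∩ L) = 0 ∧ #(B' ∩ L) = 0 ∧ #(A ∩ J) + #(B' ∩ J) ≤ 1 ∧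
          #(A' ∩ J) + #(B ∩ J) ≤ 1)) := fun ab B B' hIab h => by
    have := hdec (A ∩ B')
    have := hdec (A' ∩ B)
    have := hle A B' I hIA
    have := hle A B' L hLA
    have := hle A' B I hIA'
    have := hle A' B L hLA'
    have := hone A B'
    have := hone A' B
    rcases h.subset_of_pair hI (subset_inter hIab hIs) with h0 | h0 | h0 | ⟨-, hY, hZ⟩
    · omega
    · omega
    · omega
    · have := hsubI _ hY
      have := hsubI _ hZ
      omega
  have t := tri A B C hIA h
  have t' := tri A' B' C' hIA' h'
  have q := quad ab B B' hIab hQab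
  have r := quad ac C C' hIac hQac
  rw [hdec A, hdec B, hdec C, hdec A', hdec B', hdec C']
  have := hbd A I; have := hbd A J; have := hbd A L
  have := hbd B I; have := hbd B J; have := hbd B L
  have := hbd C I; have := hbd C J; have := hbd C L
  have := hbd A' I; have := hbd A' J; have := hbd A' L
  have := hbd B' I; have := hbd B' J; have := hbd B' L
  have := hbd C' I; have := hbd C' J; have := hbd C' L
  clear tri quad hdec hbd hsubI hle hone h h' hQab hQac
  rcases t with t | t | t | t <;> rcases t' with t' | t' | t' | t' <;>
    rcases q with q | q | q | q <;> rcases r with r | r | r | r <;> omega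

lemma star_pair_le_of_common {ab ac bc A B C A' B' C' s : Finset (Fin 4)}
    (hK : 3 ≤ #(ab ∩ ac ∩ bc)) (hP : 3 ≤ #(A ∩ A' ∩ s))
    (h : NoSDR (ab ∩ C) (ac ∩ B) (A ∩ bc)) (h' : NoSDR (ab ∩ C') (ac ∩ B') (A' ∩ bc))
    (hQab : NoSDR (ab ∩ s) (A ∩ B') (A' ∩ B)) (hQac : NoSDR (ac ∩ s) (A ∩ C') (A' ∩ C)) :
    (#A + #B + #C) + (#A' + #B' + #C') ≤ 16 := by
  obtain ⟨K, hKs, hK⟩ := exists_subset_card_eq hK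
  obtain ⟨P, hPs, hP⟩ := exists_subset_card_eq hP
  simp only [subset_inter_iff] at hKs hPs
  obtain ⟨⟨hab, hac⟩, hbc⟩ := hKs
  obtain ⟨⟨hA, hA'⟩, hs⟩ := hPs
  rcases eq_or_ne K P with rfl | hne
  · exact star_pair_le_of_common_eq hK hab hac hbc hA hA' hs h h' hQab hQac
  · have h1 := card_add_card_le_inter K P
    have h2 : #(K ∩ P) < 3 := by
      by_contra! hc
      have e1 := eq_of_subset_of_card_le (inter_subset_left : K ∩ P ⊆ K) (by omega)
      have e2 := eq_of_subset_of_card_le (inter_subset_right : K ∩ P ⊆ P) (by omega)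
      exact hne (e1.symm.trans e2)
    have h3 := card_sdiff_add_card_inter K P
    have h4 := card_sdiff_add_card_inter P K
    rw [inter_comm] at h4
    have eK : K ∩ P ∪ K \ P = K := by rw [union_comm]; exact sdiff_union_inter K P
    have eP : K ∩ P ∪ P \ K = P := by
      rw [union_comm, inter_comm]; exact sdiff_union_inter P K
    refine star_pair_le_of_common_ne (I := K ∩ P) (J := K \ P) (L := P \ K) (by omega) (by omega)
      (by omega) ?_ ?_ ?_ (eK.symm ▸ hab) (eK.symm ▸ hac) (eK.symm ▸ hbc) (eP.symm ▸ hA)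
      (eP.symm ▸ hA') (eP.symm ▸ hs) h h' hQab hQac
    · exact (disjoint_sdiff_inter K P).symm
    · rw [inter_comm]; exact (disjoint_sdiff_inter P K).symm
    · exact disjoint_sdiff_sdiff

lemma no_two_common {ab A B A' B' s : Finset (Fin 4)} (hab : 3 ≤ #ab)
    (hP : 3 ≤ #(A ∩ A' ∩ s)) (hR : 3 ≤ #(B ∩ B' ∩ s))
    (h : NoSDR (ab ∩ s) (A ∩ B') (A' ∩ B)) : False := by
  have hsub : ∀ X Y Z W : Finset (Fin 4), X ⊆ Z → Y ⊆ W → #X + #Y ≤ #(Z ∩ W) + 4 :=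
    fun X Y Z W hX hY => (card_add_card_le_inter X Y).trans
      (by gcongr)
  have e1 := hsub (A ∩ A' ∩ s) (B ∩ B' ∩ s) A B'
    (inter_subset_left.trans inter_subset_left) (inter_subset_left.trans inter_subset_right)
  have e2 := hsub (A ∩ A' ∩ s) (B ∩ B' ∩ s) A' B
    (inter_subset_left.trans inter_subset_right) (inter_subset_left.trans inter_subset_left)
  have e3 := hsub ab (A ∩ A' ∩ s) ab s subset_rfl inter_subset_right
  rcases h.hall with h | h | h | h | h | h | h
  iterate 3 omega
  · have := card_le_card (subset_union_left : ab ∩ s ⊆ ab ∩ s ∪ A ∩ B'); omega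
  · have := card_le_card (subset_union_left : ab ∩ s ⊆ ab ∩ s ∪ A' ∩ B); omega
  · have := card_le_card (subset_union_left : A ∩ B' ⊆ A ∩ B' ∪ A' ∩ B); omega
  · have hfill : ab ∩ (A ∩ A' ∩ s ∪ B ∩ B' ∩ s) ⊆ ab ∩ s ∪ A ∩ B' ∪ A' ∩ B :=
      (inter_subset_inter_left (union_subset inter_subset_right inter_subset_right)).trans
        (subset_union_left.trans subset_union_left)
    have hmeet : (A ∩ A' ∩ s) ∩ (B ∩ B' ∩ s) ⊆ ab ∩ s ∪ A ∩ B' ∪ A' ∩ B :=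
      (inter_subset_inter (inter_subset_left.trans inter_subset_left)
        (inter_subset_left.trans inter_subset_right)).trans
        (subset_union_right.trans subset_union_left)
    have h1 := card_le_card hfill
    have h2 := card_le_card hmeet
    have h3 := card_add_card_le_inter ab (A ∩ A' ∩ s ∪ B ∩ B' ∩ s)
    have h4 := card_union_add_card_inter (A ∩ A' ∩ s) (B ∩ B' ∩ s)
    omega

lemma weighted_sum_le {α : Type*} {T R : Finset α} {m : α → α → ℕ} {g : α → α → α → ℕ} {κ : ℕ}
    (hstar : ∀ d ∈ R, ∑ x ∈ T, m x d ≤ κ)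
    (hpair : ∀ d ∈ R, ∀ d' ∈ R,
      ∑ x ∈ T, m x d + ∑ x ∈ T, m x d' + 2 * ∑ x ∈ T, g x d d' ≤ 2 * κ)
    {N : ℕ} (hN : #R ≤ N) :
    N * ∑ d ∈ R, ∑ x ∈ T, m x d + ∑ d ∈ R, ∑ d' ∈ R, ∑ x ∈ T, g x d d' ≤ κ * N * #R := by
  have h1 : ∑ d ∈ R, ∑ x ∈ T, m x d ≤ #R * κ := by
    simpa using sum_le_sum hstar
  have h2 := sum_le_sum fun d hd => sum_le_sum (hpair d hd)
  simp only [sum_add_distrib, sum_const, smul_eq_mul, ← mul_sum] at h2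
  obtain ⟨k, rfl⟩ := Nat.exists_eq_add_of_le hN
  nlinarith [Nat.mul_le_mul_left k h1]

section Sums

variable {α : Type*} [DecidableEq α]

lemma sum_pair_split {m : α → α → ℕ} (hm : ∀ x y, m x y = m y x) {T U : Finset α} (hT : T ⊆ U) :
    ∑ x ∈ U, ∑ y ∈ U, m x y = ∑ x ∈ U \ T, ∑ y ∈ U \ T, m x y +
      2 * ∑ d ∈ U \ T, ∑ x ∈ T, m x d + ∑ x ∈ T, ∑ y ∈ T, m x y := by
  have hsplit : ∀ f : α → ℕ, ∑ x ∈ U, f x = ∑ x ∈ U \ T, f x + ∑ x ∈ T, f x :=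
    fun f => (sum_sdiff hT).symm
  have hcomm : ∑ x ∈ T, ∑ d ∈ U \ T, m x d = ∑ d ∈ U \ T, ∑ x ∈ T, m x d := sum_comm
  simp only [hsplit, sum_add_distrib, hcomm]
  simp only [fun d x => hm d x]
  rw [sum_congr rfl fun x _ => sum_congr rfl fun y _ => hm x y]
  ring

lemma sum_triple_split_le {g : α → α → α → ℕ} (h12 : ∀ x y z, g x y z = g y x z)
    (h23 : ∀ x y z, g x y z = g x z y) (hg : ∀ x y z, g x y z ≤ 4) {T U : Finset α}
    (hT : T ⊆ U) :
    ∑ x ∈ U, ∑ y ∈ U, ∑ z ∈ U, g x y z ≤ ∑ x ∈ U \ T, ∑ y ∈ U \ T, ∑ z ∈ U \ T, g x y z +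
      3 * ∑ d ∈ U \ T, ∑ d' ∈ U \ T, ∑ x ∈ T, g x d d' + 12 * #(U \ T) * #T ^ 2 +
      4 * #T ^ 3 := by
  have hsplit : ∀ f : α → ℕ, ∑ x ∈ U, f x = ∑ x ∈ U \ T, f x + ∑ x ∈ T, f x :=
    fun f => (sum_sdiff hT).symm
  have hbd : ∀ A B C : Finset α, ∑ x ∈ A, ∑ y ∈ B, ∑ z ∈ C, g x y z ≤ 4 * (#A * #B * #C) :=
    fun A B C => by
      calc _ ≤ ∑ x ∈ A, ∑ y ∈ B, ∑ z ∈ C, 4 := by gcongr; exact hg _ _ _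
        _ = _ := by simp; ring
  set R := U \ T
  have e1 : ∑ x ∈ T, ∑ y ∈ R, ∑ z ∈ R, g x y z = ∑ d ∈ R, ∑ d' ∈ R, ∑ x ∈ T, g x d d' := by
    rw [sum_comm]
    exact sum_congr rfl fun _ _ => sum_comm
  have e2 : ∑ x ∈ R, ∑ y ∈ T, ∑ z ∈ R, g x y z = ∑ d ∈ R, ∑ d' ∈ R, ∑ x ∈ T, g x d d' := by
    refine sum_congr rfl fun d _ => ?_
    rw [sum_comm]
    exact sum_congr rfl fun _ _ => sum_congr rfl fun _ _ => h12 _ _ _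
  have e3 : ∑ x ∈ R, ∑ y ∈ R, ∑ z ∈ T, g x y z = ∑ d ∈ R, ∑ d' ∈ R, ∑ x ∈ T, g x d d' :=
    sum_congr rfl fun d _ => sum_congr rfl fun d' _ => sum_congr rfl fun x _ => by
      rw [h23, h12]
  have b1 := hbd T T R
  have b2 := hbd T R T
  have b3 := hbd R T T
  have b4 := hbd T T T
  simp only [hsplit, sum_add_distrib]
  rw [e1, e2, e3]
  nlinarith

/-- Deleting a triple of vertices decreases the potential by a controlled amount. -/
lemma potential_removal_le {m : α → α → ℕ} {g : α → α → α → ℕ}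
    (hm : ∀ x y, m x y = m y x) (hm4 : ∀ x y, m x y ≤ 4)
    (h12 : ∀ x y z, g x y z = g y x z) (h23 : ∀ x y z, g x y z = g x z y)
    (hg : ∀ x y z, g x y z ≤ 4) {T U : Finset α} (hT : T ⊆ U) (hT3 : #T = 3) {κ : ℕ}
    (hstar : ∀ d ∈ U \ T, ∑ x ∈ T, m x d ≤ κ)
    (hpair : ∀ d ∈ U \ T, ∀ d' ∈ U \ T,
      ∑ x ∈ T, m x d + ∑ x ∈ T, m x d' + 2 * ∑ x ∈ T, g x d d' ≤ 2 * κ)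
    {N : ℕ} (hN : #U ≤ N) :
    3 * N * ∑ x ∈ U, ∑ y ∈ U, m x y + 2 * ∑ x ∈ U, ∑ y ∈ U, ∑ z ∈ U, g x y z ≤
      3 * N * ∑ x ∈ U \ T, ∑ y ∈ U \ T, m x y +
        2 * ∑ x ∈ U \ T, ∑ y ∈ U \ T, ∑ z ∈ U \ T, g x y z + 6 * κ * N * #(U \ T) + 324 * N := by
  have hcard : #(U \ T) + 3 = #U := by rw [← hT3]; exact card_sdiff_add_card_eq_card hT
  have h1 := sum_pair_split hm hT
  have h2 := sum_triple_split_le h12 h23 hg hT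
  have h3 := weighted_sum_le hstar hpair (N := N) (by omega)
  have h4 : ∑ x ∈ T, ∑ y ∈ T, m x y ≤ 36 := by
    calc _ ≤ ∑ x ∈ T, ∑ y ∈ T, 4 := by gcongr; exact hm4 _ _
      _ = 36 := by simp [hT3]
  rw [hT3] at h2
  rw [h1]
  have h5 := Nat.mul_le_mul_left (3 * N) h4
  nlinarith

/-- If every subset of `U` either contains a cheap triple or has small potential, then `U` has
small potential. -/
lemma potential_le {m : α → α → ℕ} {g : α → α → α → ℕ}
    (hm : ∀ x y, m x y = m y x) (hm4 : ∀ x y, m x y ≤ 4)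
    (h12 : ∀ x y z, g x y z = g y x z) (h23 : ∀ x y z, g x y z = g x z y)
    (hg : ∀ x y z, g x y z ≤ 4) {κ C N : ℕ} (hC : 108 ≤ C) (U : Finset α) (hN : #U ≤ N)
    (h : ∀ W ⊆ U, (∃ T ⊆ W, #T = 3 ∧ (∀ d ∈ W \ T, ∑ x ∈ T, m x d ≤ κ) ∧
        ∀ d ∈ W \ T, ∀ d' ∈ W \ T,
          ∑ x ∈ T, m x d + ∑ x ∈ T, m x d' + 2 * ∑ x ∈ T, g x d d' ≤ 2 * κ) ∨
      3 * N * ∑ x ∈ W, ∑ y ∈ W, m x y + 2 * ∑ x ∈ W, ∑ y ∈ W, ∑ z ∈ W, g x y z ≤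
        κ * N * #W ^ 2 + C * N * #W) :
    3 * N * ∑ x ∈ U, ∑ y ∈ U, m x y + 2 * ∑ x ∈ U, ∑ y ∈ U, ∑ z ∈ U, g x y z ≤
      κ * N * #U ^ 2 + C * N * #U := by
  induction U using Finset.strongInduction with
  | H U ih =>
    rcases h U subset_rfl with ⟨T, hT, hT3, hstar, hpair⟩ | h0
    · have hne : T.Nonempty := card_pos.1 (by omega)
      have hss : U \ T ⊂ U := sdiff_ssubset hT hne
      have hcard : #(U \ T) + 3 = #U := by rw [← hT3]; exact card_sdiff_add_card_eq_card hT
      have h1 := ih (U \ T) hss (by omega) fun W hW => h W (hW.trans hss.1)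
      have h2 := potential_removal_le hm hm4 h12 h23 hg hT hT3 hstar hpair hN
      have h3 := Nat.mul_le_mul_right N hC
      rw [← hcard]
      nlinarith
    · exact h0

/-- A symmetric function on pairs is at most `3` on average if every subset on which it is not
contains a nonempty set of at most three vertices sending at most `3` per vertex outside. -/
lemma sum_pair_le {m : α → α → ℕ} (hm : ∀ x y, m x y = m y x) (hm4 : ∀ x y, m x y ≤ 4)
    (U : Finset α)
    (h : ∀ W ⊆ U, (∃ T ⊆ W, 0 < #T ∧ #T ≤ 3 ∧ ∀ d ∈ W \ T, ∑ x ∈ T, m x d ≤ 3 * #T) ∨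
      ∀ x ∈ W, ∀ y ∈ W, m x y ≤ 3) :
    ∑ x ∈ U, ∑ y ∈ U, m x y ≤ 3 * #U ^ 2 + 3 * #U := by
  induction U using Finset.strongInduction with
  | H U ih =>
    rcases h U subset_rfl with ⟨T, hT, hpos, hle, hstar⟩ | h0
    · have hss : U \ T ⊂ U := sdiff_ssubset hT (card_pos.1 hpos)
      have hcard : #(U \ T) + #T = #U := card_sdiff_add_card_eq_card hT
      have h1 := ih (U \ T) hss fun W hW => h W (hW.trans hss.1)
      have h2 : ∑ x ∈ T, ∑ y ∈ T, m x y ≤ 4 * #T ^ 2 := by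
        calc _ ≤ ∑ x ∈ T, ∑ y ∈ T, 4 := by gcongr; exact hm4 _ _
          _ = _ := by simp; ring
      have h3 : ∑ d ∈ U \ T, ∑ x ∈ T, m x d ≤ #(U \ T) * (3 * #T) := by
        simpa using sum_le_sum hstar
      rw [sum_pair_split hm hT, ← hcard]
      nlinarith [Nat.mul_le_mul_left #T hle]
    · calc _ ≤ ∑ x ∈ U, ∑ y ∈ U, 3 := sum_le_sum fun x hx => sum_le_sum fun y hy => h0 x hx y hy
        _ ≤ _ := by simp; nlinarith

end Sums

/-- Label sets `s x y ⊆ Fin 4` on the pairs of `U` such that the three perfect matchings of a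
quadruple never carry distinct common labels. Links of the vertices of a complete 3-graph on four
vertices inside an `𝔽`-free 3-graph have this property. -/
structure IsLabelling {α : Type*} (s : α → α → Finset (Fin 4)) (U : Finset α) : Prop where
  symm : ∀ x y, s x y = s y x
  self : ∀ x, s x x = ∅
  noSDR : ∀ a ∈ U, ∀ b ∈ U, ∀ c ∈ U, ∀ d ∈ U, a ≠ b → a ≠ c → a ≠ d → b ≠ c → b ≠ d → c ≠ d →
    NoSDR (s a b ∩ s c d) (s a c ∩ s b d) (s a d ∩ s b c)

/-- The common labels of the three pairs of a triple. -/
def triLabels {α : Type*} (s : α → α → Finset (Fin 4)) (x y z : α) : Finset (Fin 4) :=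
  s x y ∩ s x z ∩ s y z

namespace IsLabelling

variable {α : Type*} {s : α → α → Finset (Fin 4)} {U : Finset α}

lemma mono (hs : IsLabelling s U) {W : Finset α} (hW : W ⊆ U) : IsLabelling s W :=
  ⟨hs.symm, hs.self, fun a ha b hb c hc d hd => hs.noSDR a (hW ha) b (hW hb) c (hW hc) d (hW hd)⟩

lemma ne_of_card_pos (hs : IsLabelling s U) {x y : α} (h : 0 < #(s x y)) : x ≠ y := by
  rintro rfl
  simp [hs.self] at h

lemma tri_swap_left (hs : IsLabelling s U) (x y z : α) :
    triLabels s x y z = triLabels s y x z := by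
  ext i
  simp only [triLabels, hs.symm x y, mem_inter]
  tauto

lemma tri_swap_right (hs : IsLabelling s U) (x y z : α) :
    triLabels s x y z = triLabels s x z y := by
  ext i
  simp only [triLabels, hs.symm y z, mem_inter]
  tauto

lemma tri_self (hs : IsLabelling s U) (x d : α) : triLabels s x d d = ∅ := by
  simp [triLabels, hs.self]

lemma card_tri_le (s : α → α → Finset (Fin 4)) (x y z : α) : #(triLabels s x y z) ≤ #(s x y) ∧
    #(triLabels s x y z) ≤ #(s x z) ∧ #(triLabels s x y z) ≤ #(s y z) :=
  ⟨card_le_card (inter_subset_left.trans inter_subset_left),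
    card_le_card (inter_subset_left.trans inter_subset_right), card_le_card inter_subset_right⟩

lemma star_le_nine (hs : IsLabelling s U) {a b c d : α} (ha : a ∈ U) (hb : b ∈ U) (hc : c ∈ U)
    (hd : d ∈ U) (hda : d ≠ a) (hdb : d ≠ b) (hdc : d ≠ c) (hab : 3 ≤ #(s a b))
    (hac : 3 ≤ #(s a c)) (hbc : 3 ≤ #(s b c)) :
    #(s a d) + #(s b d) + #(s c d) ≤ 9 := by
  refine _root_.star_le_nine hab hac hbc ?_
  rw [inter_comm (s b c)]
  exact hs.noSDR a ha b hb c hc d hd (hs.ne_of_card_pos (by omega)) (hs.ne_of_card_pos (by omega))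
    hda.symm (hs.ne_of_card_pos (by omega)) hdb.symm hdc.symm

variable [DecidableEq α]

lemma sum_card_le (hs : IsLabelling s U) :
    ∑ x ∈ U, ∑ y ∈ U, #(s x y) ≤ 3 * #U ^ 2 + 3 * #U := by
  refine sum_pair_le (fun x y => by rw [hs.symm]) (fun _ _ => card_label_le _) U fun W hW => ?_
  by_cases hfull : ∃ a ∈ W, ∃ b ∈ W, #(s a b) = 4
  · left
    obtain ⟨a, ha, b, hb, hab⟩ := hfull
    have nab : a ≠ b := hs.ne_of_card_pos (by omega)
    by_cases hc : ∃ c ∈ W \ {a, b}, 7 ≤ #(s a c) + #(s b c)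
    · obtain ⟨c, hc, h7⟩ := hc
      simp only [mem_sdiff, mem_insert, mem_singleton, not_or, ← ne_eq] at hc
      obtain ⟨hc, nca, ncb⟩ := hc
      have h1 := card_label_le (s a c)
      have h2 := card_label_le (s b c)
      have hT : #({a, b, c} : Finset α) = 3 := card_eq_three.2
        ⟨a, b, c, nab, nca.symm, ncb.symm, rfl⟩
      refine ⟨{a, b, c}, by simp [insert_subset_iff, *], by omega, hT.le, fun d hd => ?_⟩
      simp only [mem_sdiff, mem_insert, mem_singleton, not_or, ← ne_eq] at hd
      obtain ⟨hd, nda, ndb, ndc⟩ := hd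
      rw [hT, sum_insert (by simp [nab, nca.symm]), sum_insert (by simp [ncb.symm]), sum_singleton]
      have := (hs.mono hW).star_le_nine ha hb hc hd nda ndb ndc (by omega) (by omega) (by omega)
      omega
    · push Not at hc
      refine ⟨{a, b}, by simp [insert_subset_iff, *], by simp [card_pair nab],
        by simp [card_pair nab], fun d hd => ?_⟩
      rw [card_pair nab, sum_pair nab]
      have := hc d hd
      omega
  · right
    push Not at hfull
    intro x hx y hy
    have := hfull x hx y hy
    have := card_label_le (s x y)
    omega

/-- The potential bound counting triples with at least three common labels. -/
lemma potential_heavy_le (hs : IsLabelling s U) {N : ℕ} (hN : #U ≤ N) :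
    3 * N * ∑ x ∈ U, ∑ y ∈ U, #(s x y) +
        2 * ∑ x ∈ U, ∑ y ∈ U, ∑ z ∈ U, (if 3 ≤ #(triLabels s x y z) then 1 else 0) ≤
      9 * N * #U ^ 2 + 108 * N * #U := by
  refine potential_le (g := fun x y z => if 3 ≤ #(triLabels s x y z) then 1 else 0)
    (fun x y => by rw [hs.symm]) (fun _ _ => card_label_le _)
    (fun x y z => by simp only [hs.tri_swap_left x y z])
    (fun x y z => by simp only [hs.tri_swap_right x y z])
    (fun _ _ _ => by split_ifs <;> omega) le_rfl U hN fun W hW => ?_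
  have hsW := hs.mono hW
  by_cases hex : ∃ a ∈ W, ∃ b ∈ W, ∃ c ∈ W, 3 ≤ #(triLabels s a b c)
  · left
    obtain ⟨a, ha, b, hb, c, hc, hK⟩ := hex
    obtain ⟨hab, hac, hbc⟩ := card_tri_le s a b c
    have nab : a ≠ b := hs.ne_of_card_pos (by omega)
    have nac : a ≠ c := hs.ne_of_card_pos (by omega)
    have nbc : b ≠ c := hs.ne_of_card_pos (by omega)
    have hsum : ∀ f : α → ℕ, ∑ x ∈ {a, b, c}, f x = f a + f b + f c := fun f => by
      rw [sum_insert (by simp [nab, nac]), sum_pair nbc, add_assoc]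
    have hstar : ∀ d ∈ W \ {a, b, c}, #(s a d) + #(s b d) + #(s c d) ≤ 9 := fun d hd => by
      simp only [mem_sdiff, mem_insert, mem_singleton, not_or, ← ne_eq] at hd
      exact hsW.star_le_nine ha hb hc hd.1 hd.2.1 hd.2.2.1 hd.2.2.2 (by omega) (by omega) (by omega)
    refine ⟨{a, b, c}, by simp [insert_subset_iff, *],
      card_eq_three.2 ⟨a, b, c, nab, nac, nbc, rfl⟩, fun d hd => by rw [hsum]; exact hstar d hd, fun d hd d' hd' => ?_⟩
    have h9 := hstar d hd
    have h9' := hstar d' hd'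
    simp only [hsum]
    rcases eq_or_ne d d' with rfl | hdd
    · simp only [hs.tri_self, card_empty]
      simp
      omega
    simp only [mem_sdiff, mem_insert, mem_singleton, not_or, ← ne_eq] at hd hd'
    obtain ⟨hd, nda, ndb, ndc⟩ := hd
    obtain ⟨hd', nda', ndb', ndc'⟩ := hd'
    have quad : ∀ {x y z : α}, x ∈ W → y ∈ W → z ∈ W → x ≠ y → x ≠ z → y ≠ z →
        3 ≤ #(triLabels s x y z) → d ≠ x → d ≠ y → d ≠ z → d' ≠ x → d' ≠ y → d' ≠ z →
        3 ≤ #(triLabels s x d d') →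
        ¬ 3 ≤ #(triLabels s y d d') ∧ ¬ 3 ≤ #(triLabels s z d d') ∧
          #(s x d) + #(s y d) + #(s z d) + (#(s x d') + #(s y d') + #(s z d')) ≤ 16 := by
      intro x y z hx hy hz nxy nxz nyz hK e1 e2 e3 e1' e2' e3' hP
      have hxy := hsW.noSDR x hx y hy d hd d' hd' nxy e1.symm e1'.symm e2.symm e2'.symm hdd
      have hxz := hsW.noSDR x hx z hz d hd d' hd' nxz e1.symm e1'.symm e3.symm e3'.symm hdd
      have k := card_tri_le s x y z
      refine ⟨fun h => no_two_common (by omega) hP h hxy,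
        fun h => no_two_common (by omega) hP h hxz,
        star_pair_le_of_common hK hP
          (hsW.noSDR x hx y hy z hz d hd nxy nxz e1.symm nyz e2.symm e3.symm)
          (hsW.noSDR x hx y hy z hz d' hd' nxy nxz e1'.symm nyz e2'.symm e3'.symm) hxy hxz⟩
    have qa := quad ha hb hc nab nac nbc hK nda ndb ndc nda' ndb' ndc'
    have qb := quad hb ha hc nab.symm nbc nac (by rwa [← hs.tri_swap_left])
      ndb nda ndc ndb' nda' ndc'
    have qc := quad hc hb ha nbc.symm nac.symm nab.symm
      (by rwa [hs.tri_swap_right, hs.tri_swap_left, hs.tri_swap_right]) ndc ndb nda ndc' ndb' nda'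
    split_ifs <;> omega
  · right
    push Not at hex
    have h0 : ∑ x ∈ W, ∑ y ∈ W, ∑ z ∈ W, (if 3 ≤ #(triLabels s x y z) then 1 else 0) = 0 :=
      sum_eq_zero fun x hx => sum_eq_zero fun y hy => sum_eq_zero fun z hz =>
        if_neg (hex x hx y hy z hz).not_ge
    have := Nat.mul_le_mul_left (3 * N) hsW.sum_card_le
    rw [h0]
    nlinarith

/-- The potential bound counting common labels of triples, for a weight `h` of small density. -/
lemma potential_edge_le (hs : IsLabelling s U) {h : α → α → α → ℕ}
    (h12 : ∀ x y z, h x y z = h y x z) (h23 : ∀ x y z, h x y z = h x z y)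
    (h1 : ∀ x y z, h x y z ≤ 1) {N C : ℕ} (hN : #U ≤ N)
    (hsmall : ∀ W ⊆ U, 4 * ∑ x ∈ W, ∑ y ∈ W, ∑ z ∈ W, h x y z ≤ 3 * #W ^ 3 + C * #W ^ 2) :
    3 * N * ∑ x ∈ U, ∑ y ∈ U, #(s x y) +
        2 * ∑ x ∈ U, ∑ y ∈ U, ∑ z ∈ U, h x y z * #(triLabels s x y z) ≤
      12 * N * #U ^ 2 + (108 + C) * N * #U := by
  have hle : ∀ x y z, h x y z * #(triLabels s x y z) ≤ #(triLabels s x y z) := fun x y z =>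
    (Nat.mul_le_mul_right _ (h1 x y z)).trans (one_mul _).le
  refine potential_le (g := fun x y z => h x y z * #(triLabels s x y z))
    (fun x y => by rw [hs.symm]) (fun _ _ => card_label_le _)
    (fun x y z => by simp only [hs.tri_swap_left x y z, h12 x y z])
    (fun x y z => by simp only [hs.tri_swap_right x y z, h23 x y z])
    (fun x y z => (hle x y z).trans (card_label_le _)) (by omega) U hN fun W hW => ?_
  have hsW := hs.mono hW
  by_cases hex : ∃ a ∈ W, ∃ b ∈ W, ∃ c ∈ W, 4 ≤ #(triLabels s a b c)
  · left
    obtain ⟨a, ha, b, hb, c, hc, hK⟩ := hex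
    obtain ⟨hab, hac, hbc⟩ := card_tri_le s a b c
    have nab : a ≠ b := hs.ne_of_card_pos (by omega)
    have nac : a ≠ c := hs.ne_of_card_pos (by omega)
    have nbc : b ≠ c := hs.ne_of_card_pos (by omega)
    have full : ∀ X : Finset (Fin 4), 4 ≤ #X → X = univ := fun X hX =>
      eq_univ_of_card X (le_antisymm (card_label_le X) hX)
    have fab := full _ (hK.trans hab)
    have fac := full _ (hK.trans hac)
    have fbc := full _ (hK.trans hbc)
    have hsum : ∀ f : α → ℕ, ∑ x ∈ {a, b, c}, f x = f a + f b + f c := fun f => by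
      rw [sum_insert (by simp [nab, nac]), sum_pair nbc, add_assoc]
    refine ⟨{a, b, c}, by simp [insert_subset_iff, *],
      card_eq_three.2 ⟨a, b, c, nab, nac, nbc, rfl⟩, fun d hd => ?_, fun d hd d' hd' => ?_⟩
    · have := card_label_le (s a d)
      have := card_label_le (s b d)
      have := card_label_le (s c d)
      rw [hsum]
      omega
    have star : ∀ d ∈ W \ {a, b, c}, NoSDR (s c d) (s b d) (s a d) := fun d hd => by
      simp only [mem_sdiff, mem_insert, mem_singleton, not_or, ← ne_eq] at hd
      simpa [fab, fac, fbc] using hsW.noSDR a ha b hb c hc d hd.1 nab nac (Ne.symm hd.2.1) nbc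
        (Ne.symm hd.2.2.1) (Ne.symm hd.2.2.2)
    have pair : ∀ x ∈ W, ∀ y ∈ W, x ≠ y → s x y = univ → d ≠ x → d ≠ y → d' ≠ x → d' ≠ y →
        NoSDR (s d d') (s x d ∩ s y d') (s x d' ∩ s y d) := fun x hx y hy nxy fxy e1 e2 e3 e4 => by
      rcases eq_or_ne d d' with rfl | hdd
      · simp [NoSDR, hs.self]
      · simpa [fxy] using hsW.noSDR x hx y hy d (mem_sdiff.1 hd).1 d' (mem_sdiff.1 hd').1 nxy
          e1.symm e3.symm e2.symm e4.symm hdd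
    have sd := star d hd
    have sd' := star d' hd'
    simp only [mem_sdiff, mem_insert, mem_singleton, not_or, ← ne_eq] at hd hd'
    obtain ⟨hd, nda, ndb, ndc⟩ := hd
    obtain ⟨hd', nda', ndb', ndc'⟩ := hd'
    have key := star_pair_le_of_full sd sd' (pair a ha b hb nab fab nda ndb nda' ndb')
      (pair a ha c hc nac fac nda ndc nda' ndc') (pair b hb c hc nbc fbc ndb ndc ndb' ndc')
    have ga := hle a d d'
    have gb := hle b d d'
    have gc := hle c d d'
    simp only [hsum]
    simp only [triLabels] at ga gb gc ⊢
    omega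
  · right
    push Not at hex
    have hg : ∑ x ∈ W, ∑ y ∈ W, ∑ z ∈ W, h x y z * #(triLabels s x y z) ≤
        2 * ∑ x ∈ W, ∑ y ∈ W, ∑ z ∈ W, h x y z +
          ∑ x ∈ W, ∑ y ∈ W, ∑ z ∈ W, (if 3 ≤ #(triLabels s x y z) then 1 else 0) := by
      simp only [mul_sum, ← sum_add_distrib]
      refine sum_le_sum fun x hx => sum_le_sum fun y hy => sum_le_sum fun z hz => ?_
      have e1 := hex x hx y hy z hz
      have e2 := h1 x y z
      interval_cases h x y z <;> split_ifs <;> omega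
    have e1 := hsW.potential_heavy_le ((card_le_card hW).trans hN)
    have e2 := hsmall W hW
    have e3 := Nat.mul_le_mul_left (#W ^ 2) ((card_le_card hW).trans hN)
    have e4 := Nat.mul_le_mul_left (C * #W) ((card_le_card hW).trans hN)
    nlinarith

end IsLabelling

section Symmetric

variable {α : Type*} [DecidableEq α]

lemma sum_triple_erase_le {h : α → α → α → ℕ} (h12 : ∀ x y z, h x y z = h y x z)
    (h23 : ∀ x y z, h x y z = h x z y) {U : Finset α} {v : α} (hv : v ∈ U) :
    ∑ x ∈ U, ∑ y ∈ U, ∑ z ∈ U, h x y z ≤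
      ∑ x ∈ U.erase v, ∑ y ∈ U.erase v, ∑ z ∈ U.erase v, h x y z +
        3 * ∑ y ∈ U, ∑ z ∈ U, h v y z := by
  have hsplit : ∀ f : α → ℕ, ∑ x ∈ U, f x = f v + ∑ x ∈ U.erase v, f x :=
    fun f => (add_sum_erase U f hv).symm
  have e1 : ∑ x ∈ U.erase v, ∑ z ∈ U, h x v z ≤ ∑ y ∈ U, ∑ z ∈ U, h v y z := by
    simp only [fun x z => h12 x v z]
    exact sum_le_sum_of_subset (erase_subset v U)
  have e2 : ∑ x ∈ U.erase v, ∑ y ∈ U.erase v, h x y v ≤ ∑ y ∈ U, ∑ z ∈ U, h v y z := by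
    simp only [fun x y => h23 x y v, fun x y => h12 x v y]
    exact (sum_le_sum fun x _ => sum_le_sum_of_subset (erase_subset v U)).trans
      (sum_le_sum_of_subset (erase_subset v U))
  calc _ = ∑ y ∈ U, ∑ z ∈ U, h v y z + (∑ x ∈ U.erase v, ∑ z ∈ U, h x v z +
        (∑ x ∈ U.erase v, ∑ y ∈ U.erase v, h x y v +
          ∑ x ∈ U.erase v, ∑ y ∈ U.erase v, ∑ z ∈ U.erase v, h x y z)) := by
        rw [hsplit, ← sum_add_distrib, ← sum_add_distrib]
        congr 1
        refine sum_congr rfl fun x _ => ?_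
        rw [hsplit, ← sum_add_distrib]
        exact congrArg _ (sum_congr rfl fun y _ => hsplit _)
    _ ≤ _ := by omega

lemma sum_quad_erase_le {k : α → α → α → α → ℕ} (h12 : ∀ x y z w, k x y z w = k y x z w)
    (h23 : ∀ x y z w, k x y z w = k x z y w) (h34 : ∀ x y z w, k x y z w = k x y w z)
    {U : Finset α} {v : α} (hv : v ∈ U) :
    ∑ x ∈ U, ∑ y ∈ U, ∑ z ∈ U, ∑ w ∈ U, k x y z w ≤
      ∑ x ∈ U.erase v, ∑ y ∈ U.erase v, ∑ z ∈ U.erase v, ∑ w ∈ U.erase v, k x y z w +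
        4 * ∑ y ∈ U, ∑ z ∈ U, ∑ w ∈ U, k v y z w := by
  have hsplit : ∀ f : α → ℕ, ∑ x ∈ U, f x = f v + ∑ x ∈ U.erase v, f x :=
    fun f => (add_sum_erase U f hv).symm
  have e1 : ∑ x ∈ U.erase v, ∑ y ∈ U, ∑ z ∈ U, k v x y z ≤ ∑ y ∈ U, ∑ z ∈ U, ∑ w ∈ U, k v y z w :=
    sum_le_sum_of_subset (erase_subset v U)
  have e2 : ∑ x ∈ U, ∑ y ∈ U, ∑ z ∈ U, k x y z v = ∑ y ∈ U, ∑ z ∈ U, ∑ w ∈ U, k v y z w := by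
    simp only [fun x y z => h34 x y z v, fun x y z => h23 x y v z, fun x y z => h12 x v y z]
  have h2 := fun x => sum_triple_erase_le (h := k x) (fun y z w => h23 x y z w)
    (fun y z w => h34 x y z w) hv
  calc _ = ∑ y ∈ U, ∑ z ∈ U, ∑ w ∈ U, k v y z w +
        ∑ x ∈ U.erase v, ∑ y ∈ U, ∑ z ∈ U, ∑ w ∈ U, k x y z w := hsplit _
    _ ≤ ∑ y ∈ U, ∑ z ∈ U, ∑ w ∈ U, k v y z w +
        ∑ x ∈ U.erase v, (∑ y ∈ U.erase v, ∑ z ∈ U.erase v, ∑ w ∈ U.erase v, k x y z w +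
          3 * ∑ y ∈ U, ∑ z ∈ U, k x v y z) := by gcongr; exact h2 _
    _ ≤ _ := by
      simp only [fun x y z => h12 x v y z, sum_add_distrib, ← mul_sum]
      omega

end Symmetric

/-- `h` is the indicator function of the ordered edges of a 3-graph. -/
structure IsEdgeIndicator {α : Type*} (h : α → α → α → ℕ) : Prop where
  swap_left : ∀ x y z, h x y z = h y x z
  swap_right : ∀ x y z, h x y z = h x z y
  le_one : ∀ x y z, h x y z ≤ 1
  self : ∀ x y, h x x y = 0

/-- The vertices `z 0, …, z 3` span a complete 3-graph. -/
def IsTetrahedron {α : Type*} (h : α → α → α → ℕ) (z : Fin 4 → α) : Prop :=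
  ∀ i j l, i ≠ j → i ≠ l → j ≠ l → h (z i) (z j) (z l) = 1

/-- The indices `i` such that `z i` spans an edge with `x` and `y`. -/
def linkLabels {α : Type*} (h : α → α → α → ℕ) (z : Fin 4 → α) (x y : α) : Finset (Fin 4) :=
  univ.filter fun i => h (z i) x y = 1

/-- The indicator of the ordered quadruples spanning a complete 3-graph. -/
def tetraIndicator {α : Type*} (h : α → α → α → ℕ) (x y z w : α) : ℕ :=
  h x y z * (h x y w * h x z w * h y z w)

/-- Every complete 3-graph on four vertices induces a labelling of the remaining vertices. -/
def LinksAreLabellings {α : Type*} (h : α → α → α → ℕ) : Prop :=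
  ∀ z U, IsTetrahedron h z → (∀ i, z i ∉ U) → IsLabelling (linkLabels h z) U

namespace IsEdgeIndicator

variable {α : Type*} {h : α → α → α → ℕ}

lemma eq_zero_or_one (hh : IsEdgeIndicator h) (x y z : α) : h x y z = 0 ∨ h x y z = 1 := by
  have := hh.le_one x y z
  omega

lemma injective (hh : IsEdgeIndicator h) {z : Fin 4 → α} (hz : IsTetrahedron h z) :
    Function.Injective z := by
  intro i j hij
  by_contra hne
  obtain ⟨l, hl, hl'⟩ : ∃ l, i ≠ l ∧ j ≠ l := by
    clear hij hne
    revert i j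
    decide
  have := hz i j l hne hl hl'
  rw [hij, hh.self] at this
  omega

lemma card_linkLabels (hh : IsEdgeIndicator h) (z : Fin 4 → α) (x y : α) :
    #(linkLabels h z x y) = ∑ i, h (z i) x y := by
  rw [linkLabels, card_filter]
  refine sum_congr rfl fun i _ => ?_
  rcases hh.eq_zero_or_one (z i) x y with e | e <;> simp [e]

lemma sum_tetraIndicator (hh : IsEdgeIndicator h) (z : Fin 4 → α) (x y w : α) :
    ∑ i, tetraIndicator h (z i) x y w = h x y w * #(triLabels (linkLabels h z) x y w) := by
  have : triLabels (linkLabels h z) x y w =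
      univ.filter fun i => h (z i) x y = 1 ∧ h (z i) x w = 1 ∧ h (z i) y w = 1 := by
    ext i
    simp [triLabels, linkLabels]
  rw [this, card_filter, mul_sum]
  refine sum_congr rfl fun i _ => ?_
  rw [tetraIndicator]
  rcases hh.eq_zero_or_one (z i) x y with e1 | e1 <;>
    rcases hh.eq_zero_or_one (z i) x w with e2 | e2 <;>
      rcases hh.eq_zero_or_one (z i) y w with e3 | e3 <;> simp [e1, e2, e3]

lemma sum_link_eq (hh : IsEdgeIndicator h) (z : Fin 4 → α) (U : Finset α) :
    ∑ i, ∑ x ∈ U, ∑ y ∈ U, h (z i) x y = ∑ x ∈ U, ∑ y ∈ U, #(linkLabels h z x y) := by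
  simp only [hh.card_linkLabels]
  rw [sum_comm]
  exact sum_congr rfl fun x _ => sum_comm

lemma isTetrahedron (hh : IsEdgeIndicator h) {x y z w : α} (h1 : h x y z = 1) (h2 : h x y w = 1)
    (h3 : h x z w = 1) (h4 : h y z w = 1) : IsTetrahedron h ![x, y, z, w] := by
  have all : ∀ {a b c : α}, h a b c = 1 → h a b c = 1 ∧ h a c b = 1 ∧ h b a c = 1 ∧ h b c a = 1 ∧
      h c a b = 1 ∧ h c b a = 1 := fun {a b c} e => by
    have e1 := hh.swap_left a b c
    have e2 := hh.swap_right a b c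
    have e3 := hh.swap_right b a c
    have e4 := hh.swap_left a c b
    have e5 := hh.swap_left b c a
    omega
  obtain ⟨_, _, _, _, _, _⟩ := all h1
  obtain ⟨_, _, _, _, _, _⟩ := all h2
  obtain ⟨_, _, _, _, _, _⟩ := all h3
  obtain ⟨_, _, _, _, _, _⟩ := all h4
  intro i j l hij hil hjl
  fin_cases i <;> fin_cases j <;> fin_cases l <;>
    first
    | exact absurd rfl hij
    | exact absurd rfl hil
    | exact absurd rfl hjl
    | assumption

lemma tetra_swap (hh : IsEdgeIndicator h) (x y z w : α) :
    tetraIndicator h x y z w = tetraIndicator h y x z w ∧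
      tetraIndicator h x y z w = tetraIndicator h x z y w ∧
        tetraIndicator h x y z w = tetraIndicator h x y w z := by
  simp only [tetraIndicator]
  refine ⟨?_, ?_, ?_⟩
  · rw [hh.swap_left x y z, hh.swap_left x y w]
    ring
  · rw [hh.swap_right x y z, hh.swap_left y z w]
    ring
  · rw [hh.swap_right x z w, hh.swap_right y z w]
    ring

variable [DecidableEq α]

lemma card_sdiff_image (hh : IsEdgeIndicator h) {z : Fin 4 → α} (hz : IsTetrahedron h z)
    {U : Finset α} (hU : univ.image z ⊆ U) : #(U \ univ.image z) + 4 = #U := by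
  have : #(univ.image z) = 4 := by rw [card_image_of_injective _ (hh.injective hz)]; simp
  have := card_sdiff_add_card_eq_card hU
  omega

lemma sum_link_split_le {z : Fin 4 → α}
    (hsymm : ∀ x y, linkLabels h z x y = linkLabels h z y x) {U : Finset α}
    (hU : univ.image z ⊆ U) :
    ∑ x ∈ U, ∑ y ∈ U, #(linkLabels h z x y) ≤
      ∑ x ∈ U \ univ.image z, ∑ y ∈ U \ univ.image z, #(linkLabels h z x y) +
        (32 * #(U \ univ.image z) + 64) := by
  have hT : #(univ.image z) ≤ 4 := card_image_le
  have h2 : ∑ d ∈ U \ univ.image z, ∑ x ∈ univ.image z, #(linkLabels h z x d) ≤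
      #(U \ univ.image z) * 16 := by
    calc _ ≤ ∑ d ∈ U \ univ.image z, ∑ x ∈ univ.image z, 4 := by gcongr; exact card_label_le _
      _ ≤ _ := by simp only [sum_const, smul_eq_mul]; gcongr; omega
  have h3 : ∑ x ∈ univ.image z, ∑ y ∈ univ.image z, #(linkLabels h z x y) ≤ 64 := by
    calc _ ≤ ∑ d ∈ univ.image z, ∑ x ∈ univ.image z, 4 := by gcongr; exact card_label_le _
      _ ≤ 4 * (4 * 4) := by simp only [sum_const, smul_eq_mul]; gcongr
  rw [sum_pair_split (fun x y => by rw [hsymm]) hU]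
  omega

lemma sum_link_le (hh : IsEdgeIndicator h) (hlab : LinksAreLabellings h) {z : Fin 4 → α}
    (hz : IsTetrahedron h z) {U : Finset α} (hU : univ.image z ⊆ U) :
    ∑ i, ∑ x ∈ U, ∑ y ∈ U, h (z i) x y ≤ 3 * #U ^ 2 + 11 * #U := by
  have hs : IsLabelling (linkLabels h z) (U \ univ.image z) := hlab z _ hz (by simp)
  have hc := hh.card_sdiff_image hz hU
  have h1 := hs.sum_card_le
  rw [hh.sum_link_eq, ← hc]
  nlinarith [sum_link_split_le hs.symm hU]

lemma sum_edge_le (hh : IsEdgeIndicator h) (hlab : LinksAreLabellings h) (U : Finset α) :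
    4 * ∑ x ∈ U, ∑ y ∈ U, ∑ z ∈ U, h x y z ≤ 3 * #U ^ 3 + 42 * #U ^ 2 := by
  induction U using Finset.strongInduction with
  | H U ih =>
    by_cases hex : ∃ z, IsTetrahedron h z ∧ univ.image z ⊆ U
    · obtain ⟨z, hz, hU⟩ := hex
      have h1 := hh.sum_link_le hlab hz hU
      obtain ⟨i, hi⟩ : ∃ i, 4 * ∑ x ∈ U, ∑ y ∈ U, h (z i) x y ≤ 3 * #U ^ 2 + 11 * #U := by
        by_contra! hc
        have c0 := hc 0
        have c1 := hc 1
        have c2 := hc 2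
        have c3 := hc 3
        rw [Fin.sum_univ_four] at h1
        omega
      have hv : z i ∈ U := hU (mem_image_of_mem z (mem_univ i))
      have h2 := ih _ (erase_ssubset hv)
      have h3 := sum_triple_erase_le hh.swap_left hh.swap_right hv
      rw [← card_erase_add_one hv] at hi ⊢
      nlinarith
    · have hpt : ∀ x ∈ U, ∀ y ∈ U, ∀ z ∈ U, ∀ w ∈ U,
          h x y z + h x y w + h x z w + h y z w ≤ 3 := fun x hx y hy z hz w hw => by
        by_contra! hc
        have e1 := hh.le_one x y z
        have e2 := hh.le_one x y w
        have e3 := hh.le_one x z w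
        have e4 := hh.le_one y z w
        refine hex ⟨_, hh.isTetrahedron (x := x) (y := y) (z := z) (w := w) (by omega) (by omega)
          (by omega) (by omega), ?_⟩
        rw [image_subset_iff]
        intro i _
        fin_cases i <;> assumption
      have hsum := sum_le_sum fun x hx => sum_le_sum fun y hy => sum_le_sum fun z hz =>
        sum_le_sum fun w hw => hpt x hx y hy z hz w hw
      simp only [sum_add_distrib, sum_const, smul_eq_mul, ← mul_sum] at hsum
      rcases Nat.eq_zero_or_pos #U with h0 | hpos
      · simp [card_eq_zero.1 h0]
      · refine (Nat.le_of_mul_le_mul_left (?_ : #U * _ ≤ #U * (3 * #U ^ 3)) hpos).trans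
          (Nat.le_add_right _ _)
        linarith

lemma sum_tetra_link_le (hh : IsEdgeIndicator h) (hlab : LinksAreLabellings h) {z : Fin 4 → α}
    (hz : IsTetrahedron h z) {U : Finset α} (hU : univ.image z ⊆ U) :
    3 * #U * ∑ i, ∑ x ∈ U, ∑ y ∈ U, h (z i) x y +
        2 * ∑ i, ∑ x ∈ U, ∑ y ∈ U, ∑ w ∈ U, tetraIndicator h (z i) x y w ≤
      12 * #U ^ 3 + 518 * #U ^ 2 := by
  have hs : IsLabelling (linkLabels h z) (U \ univ.image z) := hlab z _ hz (by simp)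
  have hc := hh.card_sdiff_image hz hU
  have hT : #(univ.image z) ≤ 4 := card_image_le
  have hle : ∀ x y w, h x y w * #(triLabels (linkLabels h z) x y w) ≤ 4 := fun x y w =>
    Nat.mul_le_mul (hh.le_one x y w) (card_label_le _)
  have e2 : ∑ i, ∑ x ∈ U, ∑ y ∈ U, ∑ w ∈ U, tetraIndicator h (z i) x y w =
      ∑ x ∈ U, ∑ y ∈ U, ∑ w ∈ U, h x y w * #(triLabels (linkLabels h z) x y w) := by
    simp only [← hh.sum_tetraIndicator]
    rw [sum_comm]
    refine sum_congr rfl fun x _ => ?_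
    rw [sum_comm]
    exact sum_congr rfl fun y _ => sum_comm
  have h1 := hs.potential_edge_le hh.swap_left hh.swap_right hh.le_one (card_le_card sdiff_subset)
    fun W _ => hh.sum_edge_le hlab W
  have h5 := sum_triple_split_le
    (g := fun x y w => h x y w * #(triLabels (linkLabels h z) x y w))
    (fun x y w => by rw [hh.swap_left, hs.tri_swap_left])
    (fun x y w => by rw [hh.swap_right, hs.tri_swap_right]) hle hU
  have h6 : ∑ d ∈ U \ univ.image z, ∑ d' ∈ U \ univ.image z, ∑ x ∈ univ.image z,
      h x d d' * #(triLabels (linkLabels h z) x d d') ≤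
        #(U \ univ.image z) * (#(U \ univ.image z) * 16) := by
    calc _ ≤ ∑ d ∈ U \ univ.image z, ∑ d' ∈ U \ univ.image z, ∑ x ∈ univ.image z, 4 := by
          gcongr; exact hle _ _ _
      _ ≤ _ := by simp only [sum_const, smul_eq_mul]; gcongr; omega
  have hT4 : #(univ.image z) = 4 := by
    have := card_sdiff_add_card_eq_card hU
    omega
  rw [hT4] at h5
  rw [hh.sum_link_eq, e2]
  have h7 : 3 * #U * ∑ x ∈ U, ∑ y ∈ U, #(linkLabels h z x y) ≤
      3 * #U * ∑ x ∈ U \ univ.image z, ∑ y ∈ U \ univ.image z, #(linkLabels h z x y) +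
        3 * #U * (32 * #(U \ univ.image z) + 64) := by
    rw [← mul_add]
    exact Nat.mul_le_mul_left _ (sum_link_split_le hs.symm hU)
  generalize #(U \ univ.image z) = r at *
  rw [← hc] at h1 h7 ⊢
  nlinarith

/-- The weighted count of edges and of complete 3-graphs on four vertices. -/
lemma sum_edge_add_tetra_le (hh : IsEdgeIndicator h) (hlab : LinksAreLabellings h)
    (U : Finset α) :
    8 * (2 * #U * ∑ x ∈ U, ∑ y ∈ U, ∑ z ∈ U, h x y z +
        ∑ x ∈ U, ∑ y ∈ U, ∑ z ∈ U, ∑ w ∈ U, tetraIndicator h x y z w) ≤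
      15 * #U ^ 4 + 2500 * #U ^ 3 := by
  induction U using Finset.strongInduction with
  | H U ih =>
    have hE := hh.sum_edge_le hlab U
    by_cases hex : ∃ z, IsTetrahedron h z ∧ univ.image z ⊆ U
    · obtain ⟨z, hz, hU⟩ := hex
      have h1 := hh.sum_tetra_link_le hlab hz hU
      obtain ⟨i, hi⟩ : ∃ i, 4 * (3 * #U * ∑ x ∈ U, ∑ y ∈ U, h (z i) x y +
          2 * ∑ x ∈ U, ∑ y ∈ U, ∑ w ∈ U, tetraIndicator h (z i) x y w) ≤
            12 * #U ^ 3 + 518 * #U ^ 2 := by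
        by_contra! hc
        have c0 := hc 0
        have c1 := hc 1
        have c2 := hc 2
        have c3 := hc 3
        rw [Fin.sum_univ_four, Fin.sum_univ_four] at h1
        linarith
      have hv : z i ∈ U := hU (mem_image_of_mem z (mem_univ i))
      have h2 := ih _ (erase_ssubset hv)
      have h3 := sum_triple_erase_le hh.swap_left hh.swap_right hv
      have h4 := sum_quad_erase_le (fun x y z w => (hh.tetra_swap x y z w).1)
        (fun x y z w => (hh.tetra_swap x y z w).2.1) (fun x y z w => (hh.tetra_swap x y z w).2.2) hv
      have h5 : ∑ x ∈ U.erase (z i), ∑ y ∈ U.erase (z i), ∑ w ∈ U.erase (z i), h x y w ≤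
          ∑ x ∈ U, ∑ y ∈ U, ∑ w ∈ U, h x y w := by
        have := erase_subset (z i) U
        exact (sum_le_sum fun x _ => (sum_le_sum fun y _ => sum_le_sum_of_subset this).trans
          (sum_le_sum_of_subset this)).trans (sum_le_sum_of_subset this)
      have hcU := card_erase_add_one hv
      have h6 := Nat.mul_le_mul_left (2 * #U) h3
      rw [← hcU] at hE hi h6 ⊢
      generalize #(U.erase (z i)) = w at *
      nlinarith
    · have hK : ∑ x ∈ U, ∑ y ∈ U, ∑ z ∈ U, ∑ w ∈ U, tetraIndicator h x y z w = 0 := by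
        refine sum_eq_zero fun x hx => sum_eq_zero fun y hy => sum_eq_zero fun z hz =>
          sum_eq_zero fun w hw => ?_
        by_contra hne
        simp only [tetraIndicator, mul_eq_zero, not_or] at hne
        obtain ⟨n1, ⟨n2, n3⟩, n4⟩ := hne
        refine hex ⟨_, hh.isTetrahedron ((hh.eq_zero_or_one x y z).resolve_left n1)
          ((hh.eq_zero_or_one x y w).resolve_left n2) ((hh.eq_zero_or_one x z w).resolve_left n3)
          ((hh.eq_zero_or_one y z w).resolve_left n4), ?_⟩
        rw [image_subset_iff]
        intro i _
        fin_cases i <;> assumption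
      rw [hK]
      nlinarith [Nat.mul_le_mul_left #U hE]

end IsEdgeIndicator

section QuadrupleSums

variable {α : Type*} [Fintype α]

/-- The sum of squared codegrees counts pairs of edges sharing two vertices, and every ordered
quadruple contains at most six such pairs. -/
lemma IsEdgeIndicator.six_mul_sum_sq_le {h : α → α → α → ℕ} (hh : IsEdgeIndicator h) :
    6 * ∑ x, ∑ y, (∑ z, h x y z) ^ 2 ≤ 2 * (2 * Fintype.card α * ∑ x, ∑ y, ∑ z, h x y z +
      ∑ x, ∑ y, ∑ z, ∑ w, tetraIndicator h x y z w) := by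
  have t12 : ∀ f : α → α → α → α → ℕ,
      ∑ x, ∑ y, ∑ z, ∑ w, f y x z w = ∑ x, ∑ y, ∑ z, ∑ w, f x y z w := fun f => sum_comm
  have t23 : ∀ f : α → α → α → α → ℕ,
      ∑ x, ∑ y, ∑ z, ∑ w, f x z y w = ∑ x, ∑ y, ∑ z, ∑ w, f x y z w :=
    fun f => sum_congr rfl fun x _ => sum_comm
  have t34 : ∀ f : α → α → α → α → ℕ,
      ∑ x, ∑ y, ∑ z, ∑ w, f x y w z = ∑ x, ∑ y, ∑ z, ∑ w, f x y z w :=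
    fun f => sum_congr rfl fun x _ => sum_congr rfl fun y _ => sum_comm
  let F : α → α → α → α → ℕ := fun a b c d => h a b c * h a b d
  have hS : ∑ x, ∑ y, (∑ z, h x y z) ^ 2 = ∑ x, ∑ y, ∑ z, ∑ w, F x y z w :=
    sum_congr rfl fun x _ => sum_congr rfl fun y _ => by rw [sq, sum_mul_sum]
  have s2 : ∑ x, ∑ y, ∑ z, ∑ w, F x z y w = ∑ x, ∑ y, ∑ z, ∑ w, F x y z w := t23 F
  have s3 : ∑ x, ∑ y, ∑ z, ∑ w, F y z x w = ∑ x, ∑ y, ∑ z, ∑ w, F x y z w :=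
    (t12 fun x y z w => F x z y w).trans s2
  have s4 : ∑ x, ∑ y, ∑ z, ∑ w, F x w y z = ∑ x, ∑ y, ∑ z, ∑ w, F x y z w :=
    (t34 fun x y z w => F x z y w).trans s2
  have s5 : ∑ x, ∑ y, ∑ z, ∑ w, F y w x z = ∑ x, ∑ y, ∑ z, ∑ w, F x y z w :=
    (t12 fun x y z w => F x w y z).trans s4
  have s6 : ∑ x, ∑ y, ∑ z, ∑ w, F z w x y = ∑ x, ∑ y, ∑ z, ∑ w, F x y z w :=
    (t23 fun x y z w => F y w x z).trans s5
  have hpt : ∀ x y z w, F x y z w + F x z y w + F y z x w + F x w y z + F y w x z + F z w x y ≤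
      h x y z + h x y w + h x z w + h y z w + 2 * tetraIndicator h x y z w := fun x y z w => by
    have e1 := hh.swap_right x z y
    have e2 := (hh.swap_right y z x).trans (hh.swap_left y x z)
    have e3 := hh.swap_right x w y
    have e4 := hh.swap_right x w z
    have e5 := (hh.swap_right y w x).trans (hh.swap_left y x w)
    have e6 := hh.swap_right y w z
    have e7 := (hh.swap_right z w x).trans (hh.swap_left z x w)
    have e8 := (hh.swap_right z w y).trans (hh.swap_left z y w)
    simp only [F, tetraIndicator, e1, e2, e3, e4, e5, e6, e7, e8]
    rcases hh.eq_zero_or_one x y z with a | a <;> rcases hh.eq_zero_or_one x y w with b | b <;>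
      rcases hh.eq_zero_or_one x z w with c | c <;> rcases hh.eq_zero_or_one y z w with d | d <;>
        simp [a, b, c, d]
  have hsum := sum_le_sum fun x (_ : x ∈ univ) => sum_le_sum fun y (_ : y ∈ univ) =>
    sum_le_sum fun z (_ : z ∈ univ) => sum_le_sum fun w (_ : w ∈ univ) => hpt x y z w
  simp only [sum_add_distrib, ← mul_sum, s2, s3, s4, s5, s6] at hsum
  simp only [sum_const, smul_eq_mul, ← mul_sum, card_univ] at hsum
  rw [hS]
  linarith

end QuadrupleSums

/-- The indicator of the ordered edges of `H`. -/
def edgeIndicator {n : ℕ} (H : Finset (Finset (Fin n))) (x y z : Fin n) : ℕ :=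
  if ({x, y, z} : Finset (Fin n)) ∈ H then 1 else 0

section Codegree

variable {n : ℕ} {H : Finset (Finset (Fin n))}

lemma edgeIndicator_eq_one {x y z : Fin n} :
    edgeIndicator H x y z = 1 ↔ ({x, y, z} : Finset (Fin n)) ∈ H := by
  simp [edgeIndicator]

lemma isEdgeIndicator (hH : Is3Graph H) : IsEdgeIndicator (edgeIndicator H) where
  swap_left x y z := by rw [edgeIndicator, edgeIndicator, Finset.insert_comm]
  swap_right x y z := by rw [edgeIndicator, edgeIndicator, pair_comm]
  le_one x y z := by
    rw [edgeIndicator]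
    split_ifs <;> simp
  self x y := if_neg fun hmem => by
    have h3 := hH _ hmem
    rw [insert_eq_of_mem (mem_insert_self x {y})] at h3
    have := card_le_two (a := x) (b := y)
    omega

lemma linksAreLabellings (hH : Is3Graph H) (hF : FanoFree H) :
    LinksAreLabellings (edgeIndicator H) := by
  intro z U hz hzU
  have hh := isEdgeIndicator hH
  refine ⟨fun x y => ?_, fun x => ?_, fun a ha b hb c hc d hd hab hac had hbc hbd hcd i hi j hj
    l hl => ?_⟩
  · simp only [linkLabels, hh.swap_right _ x y]
  · refine filter_eq_empty_iff.2 fun i _ => ?_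
    rw [hh.swap_left, hh.swap_right, hh.self]
    simp
  · by_contra! hne
    obtain ⟨hij, hil, hjl⟩ := hne
    simp only [linkLabels, mem_inter, mem_filter, mem_univ, true_and, edgeIndicator_eq_one]
      at hi hj hl
    have hinj := hh.injective hz
    have hzij := hinj.ne hij
    have hzil := hinj.ne hil
    have hzjl := hinj.ne hjl
    have nz : ∀ k, ∀ u ∈ U, z k ≠ u := fun k u hu he => hzU k (he ▸ hu)
    refine hF ⟨![z l, z j, z i, a, b, c, d], ?_, ?_⟩
    · have ne : ∀ k, z k ≠ a ∧ z k ≠ b ∧ z k ≠ c ∧ z k ≠ d := fun k =>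
        ⟨nz k a ha, nz k b hb, nz k c hc, nz k d hd⟩
      obtain ⟨_, _, _, _⟩ := ne i
      obtain ⟨_, _, _, _⟩ := ne j
      obtain ⟨_, _, _, _⟩ := ne l
      rw [← List.nodup_ofFn]
      simp [List.ofFn_succ, *, Ne.symm, ne_comm]
    · have hz3 := edgeIndicator_eq_one.1 (hz l j i hjl.symm hil.symm hij.symm)
      intro e he
      simp only [fanoEdges, mem_insert, mem_singleton] at he
      rcases he with rfl | rfl | rfl | rfl | rfl | rfl | rfl <;>
        simp only [image_insert, image_singleton]
      · exact hz3
      · exact hi.1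
      · convert hl.2 using 1
        ext v
        simp
        tauto
      · convert hl.1 using 1
        ext v
        simp
        tauto
      · convert hj.2 using 1
        ext v
        simp
        tauto
      · convert hi.2 using 1
        ext v
        simp
        tauto
      · exact hj.1

lemma codeg3_pair (hH : Is3Graph H) {x y : Fin n} (hxy : x ≠ y) :
    codeg3 H {x, y} = ∑ z, edgeIndicator H x y z := by
  simp only [codeg3, edgeIndicator, ← card_filter]
  congr 1
  ext v
  simp only [mem_filter, mem_univ, true_and]
  have hset : insert v ({x, y} : Finset (Fin n)) = {x, y, v} := by
    ext u
    simp only [mem_insert, mem_singleton]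
    tauto
  rw [hset]
  refine ⟨And.right, fun hv => ⟨fun hmem => ?_, hv⟩⟩
  have h3 := hH _ hv
  rw [← hset, insert_eq_of_mem hmem, card_pair hxy] at h3
  omega

lemma two_mul_l2norm (hH : Is3Graph H) :
    2 * l2norm H = ∑ x, ∑ y, (∑ z, edgeIndicator H x y z) ^ 2 := by
  have hh := isEdgeIndicator hH
  have e1 : ∑ x, ∑ y, (∑ z, edgeIndicator H x y z) ^ 2 =
      ∑ p ∈ univ.offDiag, codeg3 H {p.1, p.2} ^ 2 := by
    rw [← sum_product', eq_comm]
    refine sum_subset_zero_on_sdiff (fun p _ => by simp) (fun p hp => ?_) fun p hp => ?_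
    · have : p.1 = p.2 := by simpa using hp
      simp [this, hh.self]
    · rw [codeg3_pair hH (mem_offDiag.1 hp).2.2]
  have e2 : ∑ p ∈ (univ : Finset (Fin n)).offDiag, codeg3 H {p.1, p.2} ^ 2 =
      ∑ e ∈ univ.powersetCard 2, ∑ p ∈ univ.offDiag with ({p.1, p.2} : Finset (Fin n)) = e,
        codeg3 H {p.1, p.2} ^ 2 :=
    (sum_fiberwise_of_maps_to (fun p hp => mem_powersetCard.2
      ⟨subset_univ _, card_pair (mem_offDiag.1 hp).2.2⟩) _).symm
  rw [e1, e2, l2norm, mul_sum]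
  refine sum_subset_zero_on_sdiff (fun e he => ?_) (fun e he => ?_) fun e he => ?_
  · exact mem_powersetCard.2 ⟨subset_univ _, (mem_filter.1 he).2.1⟩
  · simp only [mem_sdiff, mem_powersetCard_univ, shadow3, mem_filter, mem_univ, true_and,
      not_and, not_exists] at he
    refine sum_eq_zero fun p hp => ?_
    rw [(mem_filter.1 hp).2, codeg3, card_eq_zero.2, zero_pow two_ne_zero]
    refine filter_eq_empty_iff.2 fun v _ hv => he.2 he.1 _ hv.2 (subset_insert v e)
  · obtain ⟨a, b, hab, rfl⟩ := card_eq_two.1 (mem_filter.1 he).2.1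
    have : (univ.offDiag.filter fun p : Fin n × Fin n => ({p.1, p.2} : Finset (Fin n)) = {a, b}) =
        {(a, b), (b, a)} := by
      ext ⟨x, y⟩
      simp only [mem_filter, mem_offDiag, mem_univ, true_and, mem_insert, mem_singleton,
        Prod.mk.injEq]
      constructor
      · rintro ⟨hxy, hs⟩
        have hx : x ∈ ({a, b} : Finset (Fin n)) := hs ▸ mem_insert_self x {y}
        have hy : y ∈ ({a, b} : Finset (Fin n)) := hs ▸ mem_insert_of_mem (mem_singleton_self y)
        simp only [mem_insert, mem_singleton] at hx hy
        rcases hx with rfl | rfl <;> rcases hy with rfl | rfl <;> simp_all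
      · rintro (⟨rfl, rfl⟩ | ⟨rfl, rfl⟩)
        · exact ⟨hab, rfl⟩
        · exact ⟨hab.symm, pair_comm _ _⟩
    rw [this, sum_pair (by simp [hab]), pair_comm b a]
    ring

lemma l2norm_le (hH : Is3Graph H) (hF : FanoFree H) :
    48 * l2norm H ≤ 15 * n ^ 4 + 2500 * n ^ 3 := by
  have hh := isEdgeIndicator hH
  have h1 := hh.sum_edge_add_tetra_le (linksAreLabellings hH hF) univ
  have h2 := hh.six_mul_sum_sq_le
  rw [← two_mul_l2norm hH] at h2
  rw [card_univ, Fintype.card_fin] at h1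
  rw [Fintype.card_fin] at h2
  omega

end Codegree

section Bipartite

/-- The 3-graph on `Fin n` of all triples meeting both the first `k` vertices and the rest. -/
def bipartiteTriples (n k : ℕ) : Finset (Finset (Fin n)) :=
  univ.filter fun e => #e = 3 ∧ (∃ x ∈ e, x.val < k) ∧ ∃ y ∈ e, ¬ y.val < k

variable {n k : ℕ}

lemma is3Graph_bipartiteTriples : Is3Graph (bipartiteTriples n k) :=
  fun _ he => (mem_filter.1 he).2.1

lemma fano_monochromatic (c : Fin 7 → Bool) :
    ∃ e ∈ fanoEdges, (∀ i ∈ e, c i = true) ∨ ∀ i ∈ e, ¬ c i = true := by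
  simp only [fanoEdges, mem_insert, mem_singleton, exists_eq_or_imp, exists_eq_left,
    forall_eq_or_imp, forall_eq]
  generalize c 0 = c0, c 1 = c1, c 2 = c2, c 3 = c3, c 4 = c4, c 5 = c5, c 6 = c6
  cases c0 <;> cases c1 <;> cases c2 <;> cases c3 <;> cases c4 <;> cases c5 <;> cases c6 <;> simp

lemma fanoFree_bipartiteTriples : FanoFree (bipartiteTriples n k) := by
  rintro ⟨f, -, hf⟩
  obtain ⟨e, he, hc⟩ := fano_monochromatic fun i => decide ((f i).val < k)
  simp only [decide_eq_true_eq] at hc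
  obtain ⟨-, ⟨x, hx, hxk⟩, y, hy, hyk⟩ := (mem_filter.1 (hf e he)).2
  obtain ⟨i, hi, rfl⟩ := mem_image.1 hx
  obtain ⟨j, hj, rfl⟩ := mem_image.1 hy
  rcases hc with hc | hc
  · exact hyk (hc j hj)
  · exact hc i hi hxk

lemma card_fin_val_lt (hk : k ≤ n) : #(univ.filter fun x : Fin n => x.val < k) = k := by
  rw [Fin.card_filter_val_lt, min_eq_right hk]

lemma card_fin_not_val_lt (hk : k ≤ n) : #(univ.filter fun x : Fin n => ¬ x.val < k) = n - k := by
  have := card_filter_add_card_filter_not (s := (univ : Finset (Fin n))) fun x => x.val < k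
  rw [card_fin_val_lt hk, card_univ, Fintype.card_fin] at this
  omega

lemma le_sum_edgeIndicator {x y : Fin n} {A : Finset (Fin n)}
    (hA : ∀ z ∈ A, ({x, y, z} : Finset (Fin n)) ∈ bipartiteTriples n k) :
    #A ≤ ∑ z, edgeIndicator (bipartiteTriples n k) x y z := by
  simp only [edgeIndicator, ← card_filter]
  exact card_le_card fun z hz => mem_filter.2 ⟨mem_univ z, hA z hz⟩

lemma bipartite_codegree_sq (hk : k ≤ n) (x y : Fin n) :
    ((if x.val < k then 1 else 0) * (if y.val < k then 0 else 1) +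
        (if x.val < k then 0 else 1) * (if y.val < k then 1 else 0)) * (n - 2) ^ 2 +
      ((if x.val < k then 1 else 0) * (if y.val < k then 1 else 0) * (n - k) ^ 2 +
        (if x.val < k then 0 else 1) * (if y.val < k then 0 else 1) * k ^ 2) ≤
      (∑ z, edgeIndicator (bipartiteTriples n k) x y z) ^ 2 + if x = y then n ^ 2 else 0 := by
  rcases eq_or_ne x y with rfl | hxy
  · have h1 : (n - k) ^ 2 ≤ n ^ 2 := Nat.pow_le_pow_left (Nat.sub_le n k) 2
    have h2 : k ^ 2 ≤ n ^ 2 := Nat.pow_le_pow_left hk 2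
    split_ifs <;> simp <;> omega
  have hmem : ∀ z, z ≠ x → z ≠ y → (x.val < k ∨ y.val < k ∨ z.val < k) →
      (¬ x.val < k ∨ ¬ y.val < k ∨ ¬ z.val < k) →
      ({x, y, z} : Finset (Fin n)) ∈ bipartiteTriples n k := fun z hzx hzy h1 h2 =>
    mem_filter.2 ⟨mem_univ _, card_eq_three.2 ⟨x, y, z, hxy, hzx.symm, hzy.symm, rfl⟩,
      by simpa using h1, by simpa using h2⟩
  have cross : ¬ (x.val < k ↔ y.val < k) →
      n - 2 ≤ ∑ z, edgeIndicator (bipartiteTriples n k) x y z := fun hc => by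
    have hcard : #(univ \ {x, y}) = n - 2 := by
      rw [card_sdiff_of_subset (subset_univ _), card_pair hxy, card_univ, Fintype.card_fin]
    rw [← hcard]
    refine le_sum_edgeIndicator fun z hz => ?_
    simp only [mem_sdiff, mem_univ, true_and, mem_insert, mem_singleton, not_or] at hz
    exact hmem z hz.1 hz.2 (by tauto) (by tauto)
  by_cases hx : x.val < k <;> by_cases hy : y.val < k
  · have : n - k ≤ ∑ z, edgeIndicator (bipartiteTriples n k) x y z := by
      rw [← card_fin_not_val_lt hk]
      refine le_sum_edgeIndicator fun z hz => ?_
      have hz := (mem_filter.1 hz).2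
      exact hmem z (by rintro rfl; exact hz hx) (by rintro rfl; exact hz hy) (by tauto) (by tauto)
    simpa [hx, hy, hxy] using Nat.pow_le_pow_left this 2
  · simpa [hx, hy, hxy] using Nat.pow_le_pow_left (cross (by tauto)) 2
  · simpa [hx, hy, hxy] using Nat.pow_le_pow_left (cross (by tauto)) 2
  · have : k ≤ ∑ z, edgeIndicator (bipartiteTriples n k) x y z := by
      conv_lhs => rw [← card_fin_val_lt hk]
      refine le_sum_edgeIndicator fun z hz => ?_
      have hz := (mem_filter.1 hz).2
      exact hmem z (by rintro rfl; exact hx hz) (by rintro rfl; exact hy hz) (by tauto) (by tauto)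
    simpa [hx, hy, hxy] using Nat.pow_le_pow_left this 2

lemma bipartite_l2norm_ge (hk : k ≤ n) :
    2 * (k * (n - k)) * (n - 2) ^ 2 + 2 * (k * (n - k)) ^ 2 ≤
      2 * l2norm (bipartiteTriples n k) + n ^ 3 := by
  have ha : ∑ x : Fin n, (if x.val < k then 1 else 0) = k := by
    rw [← card_filter, card_fin_val_lt hk]
  have hb : ∑ x : Fin n, (if x.val < k then 0 else 1) = n - k := by
    rw [← card_fin_not_val_lt hk, card_filter]
    exact sum_congr rfl fun x _ => by split_ifs <;> rfl
  have hsum := sum_le_sum fun x (_ : x ∈ univ) => sum_le_sum fun y (_ : y ∈ univ) =>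
    bipartite_codegree_sq hk x y
  simp only [sum_add_distrib, ← sum_mul, ← sum_mul_sum, ← two_mul_l2norm is3Graph_bipartiteTriples,
    ha, hb, sum_ite_eq, mem_univ, if_true, sum_const, card_univ, Fintype.card_fin,
    smul_eq_mul] at hsum
  nlinarith

/-- The lower bound for `ex_{ℓ2}(n, 𝔽)`, attained by a balanced partition. -/
lemma balanced_l2norm_ge (n : ℕ) :
    5 * n ^ 4 ≤ 16 * l2norm (bipartiteTriples n (n / 2)) + 24 * n ^ 3 := by
  rcases Nat.lt_or_ge n 2 with hn | hn
  · interval_cases n <;> simp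
  have h := bipartite_l2norm_ge (n := n) (Nat.div_le_self n 2)
  have hP : n ^ 2 ≤ 4 * (n / 2 * (n - n / 2)) + 1 := by
    rcases Nat.even_or_odd' n with ⟨m, rfl | rfl⟩
    · rw [Nat.mul_div_cancel_left m two_pos, two_mul, Nat.add_sub_cancel]
      nlinarith
    · have e1 : (2 * m + 1) / 2 = m := by omega
      have e2 : 2 * m + 1 - m = m + 1 := by omega
      rw [e1, e2]
      nlinarith
  generalize n / 2 * (n - n / 2) = P at *
  generalize l2norm (bipartiteTriples n (n / 2)) = L at *
  obtain ⟨t, rfl⟩ := Nat.exists_eq_add_of_le' hn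
  rw [Nat.add_sub_cancel] at h
  have h1 := Nat.mul_le_mul_right (t ^ 2) hP
  have h2 := Nat.mul_le_mul hP hP
  nlinarith

end Bipartite

lemma bddAbove_l2norm (n : ℕ) : BddAbove
    {m : ℕ | ∃ H : Finset (Finset (Fin n)), Is3Graph H ∧ FanoFree H ∧ l2norm H = m} := by
  refine ⟨15 * n ^ 4 + 2500 * n ^ 3, ?_⟩
  rintro m ⟨H, hH, hF, rfl⟩
  have := l2norm_le hH hF
  omega

lemma exL2_le (n : ℕ) : 48 * exL2 n ≤ 15 * n ^ 4 + 2500 * n ^ 3 := by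
  have hmem := fun hne => Nat.sSup_mem hne (bddAbove_l2norm n)
  obtain ⟨H, hH, hF, h⟩ := hmem
    ⟨_, _, is3Graph_bipartiteTriples (k := 0), fanoFree_bipartiteTriples, rfl⟩
  rw [exL2, ← h]
  exact l2norm_le hH hF

lemma le_exL2 (n : ℕ) : 5 * n ^ 4 ≤ 16 * exL2 n + 24 * n ^ 3 := by
  have h : l2norm (bipartiteTriples n (n / 2)) ≤ exL2 n :=
    le_csSup (bddAbove_l2norm n) ⟨_, is3Graph_bipartiteTriples, fanoFree_bipartiteTriples, rfl⟩
  have := balanced_l2norm_ge n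
  omega

end FanoDensity

/-- The ℓ2-norm Turán density of the Fano plane equals 5/16:
`ex_{ℓ2}(n, 𝔽)/n⁴ → 5/16` as `n → ∞`. -/
theorem fano_l2_density :
    Filter.Tendsto (fun n : ℕ => (exL2 n : ℝ) / (n : ℝ) ^ 4) Filter.atTop
      (nhds (5 / 16)) := by
  have hlow : Filter.Tendsto (fun n : ℕ => (5 / 16 : ℝ) - 24 / 16 / n) Filter.atTop
      (nhds (5 / 16)) := by
    simpa using tendsto_const_nhds.sub (tendsto_const_div_atTop_nhds_zero_nat (24 / 16 : ℝ))
  have hupp : Filter.Tendsto (fun n : ℕ => (5 / 16 : ℝ) + 2500 / 48 / n) Filter.atTop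
      (nhds (5 / 16)) := by
    simpa using tendsto_const_nhds.add (tendsto_const_div_atTop_nhds_zero_nat (2500 / 48 : ℝ))
  refine tendsto_of_tendsto_of_tendsto_of_le_of_le' hlow hupp ?_ ?_
  · filter_upwards [Filter.eventually_gt_atTop 0] with n hn
    have hn : (0 : ℝ) < n := by exact_mod_cast hn
    have h : (5 * n ^ 4 : ℝ) ≤ 16 * exL2 n + 24 * n ^ 3 := by exact_mod_cast le_exL2 n
    rw [le_div_iff₀ (by positivity)]
    have e : (5 / 16 - 24 / 16 / (n : ℝ)) * n ^ 4 = 5 / 16 * n ^ 4 - 24 / 16 * n ^ 3 := by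
      field_simp
    linarith
  · filter_upwards [Filter.eventually_gt_atTop 0] with n hn
    have hn : (0 : ℝ) < n := by exact_mod_cast hn
    have h : (48 * exL2 n : ℝ) ≤ 15 * n ^ 4 + 2500 * n ^ 3 := by exact_mod_cast exL2_le n
    rw [div_le_iff₀ (by positivity)]
    have e : (5 / 16 + 2500 / 48 / (n : ℝ)) * n ^ 4 = 5 / 16 * n ^ 4 + 2500 / 48 * n ^ 3 := by
      field_simp
    linarith
end

section
/- For every integer n ≥ 632, the maximum size of a 𝕂₄-free 5-multigraph on n vertices equals 2·C(n,2) + 3·⌊n²/4⌋; that is, ex₅(n, 𝕂₄) = 2·C(n,2) + 3·⌊n²/4⌋. -/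
/-- A 5-multigraph `(G₁,…,G₅)` on `Fin n`: each `G i` is the edge set of a simple graph,
so every edge is a 2-element subset. -/
def IsMulti5 {n : ℕ} (G : Fin 5 → Finset (Finset (Fin n))) : Prop :=
  ∀ i, ∀ e ∈ G i, e.card = 2

/-- The size of a 5-multigraph: `|𝒢| = ∑ᵢ |Gᵢ|`. -/
def msize {n : ℕ} (G : Fin 5 → Finset (Finset (Fin n))) : ℕ := ∑ i, (G i).card

/-- The degree of a vertex in a 5-multigraph: `d_𝒢(v) = ∑ᵢ d_{Gᵢ}(v)`. -/
def mdeg {n : ℕ} (G : Fin 5 → Finset (Finset (Fin n))) (v : Fin n) : ℕ :=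
  ∑ i, ((G i).filter fun e => v ∈ e).card

/-- The multiplicity of a pair `{u,v}`: the number of indices `i` with `uv ∈ Gᵢ`. -/
def mult5 {n : ℕ} (G : Fin 5 → Finset (Finset (Fin n))) (u v : Fin n) : ℕ :=
  (Finset.univ.filter fun i : Fin 5 => ({u, v} : Finset (Fin n)) ∈ G i).card

/-- A 5-multigraph contains `𝕂₄` if there are three distinct indices `i, j, k` and four
distinct vertices `a, b, c, d` with `{ab, cd} ⊆ Gᵢ`, `{ac, bd} ⊆ Gⱼ`, `{ad, bc} ⊆ G_k`. -/
def ContainsK4 {n : ℕ} (G : Fin 5 → Finset (Finset (Fin n))) : Prop :=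
  ∃ i j k : Fin 5, ∃ a b c d : Fin n,
    i ≠ j ∧ i ≠ k ∧ j ≠ k ∧
    a ≠ b ∧ a ≠ c ∧ a ≠ d ∧ b ≠ c ∧ b ≠ d ∧ c ≠ d ∧
    ({a, b} : Finset (Fin n)) ∈ G i ∧ ({c, d} : Finset (Fin n)) ∈ G i ∧
    ({a, c} : Finset (Fin n)) ∈ G j ∧ ({b, d} : Finset (Fin n)) ∈ G j ∧
    ({a, d} : Finset (Fin n)) ∈ G k ∧ ({b, c} : Finset (Fin n)) ∈ G k

/-- `ex₅(n, 𝕂₄)`: the maximum size of a 𝕂₄-free 5-multigraph on n vertices. -/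
noncomputable def ex5K4 (n : ℕ) : ℕ :=
  sSup {m : ℕ | ∃ G : Fin 5 → Finset (Finset (Fin n)),
    IsMulti5 G ∧ ¬ ContainsK4 G ∧ msize G = m}

/-- The edge multiplicities of a `𝕂₄`-free 5-multigraph whose degrees are all at least
`7 * n / 2 - 8`. The field `quad` bounds the multiplicities on any four vertices: the sets of
colours common to two opposite pairs have no system of three distinct representatives. -/
structure IsDense5 {n : ℕ} (w : Fin n → Fin n → ℕ) : Prop where
  symm : ∀ u v, w u v = w v u
  le_five : ∀ u v, w u v ≤ 5
  quad : ∀ x y z v,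
    w v x + w y z ≤ 5 ∨ w v y + w x z ≤ 5 ∨ w v z + w x y ≤ 5 ∨
    (w v x + w y z ≤ 6 ∧ w v y + w x z ≤ 6) ∨
    (w v x + w y z ≤ 6 ∧ w v z + w x y ≤ 6) ∨
    (w v y + w x z ≤ 6 ∧ w v z + w x y ≤ 6) ∨
    (w v x + w y z ≤ 7 ∧ w v y + w x z ≤ 7 ∧ w v z + w x y ≤ 7)
  large : 632 ≤ n
  deg : ∀ v, 7 * n ≤ 2 * ∑ u, w u v + 16

namespace IsDense5
variable {n : ℕ} {w : Fin n → Fin n → ℕ}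

/-- If a weighted sum of three degrees is large, some vertex sends a large weighted sum. -/
theorem exists_lt (h : IsDense5 w) (α β γ M : ℕ) (x y z : Fin n)
    (hM : 2 * M * n + 16 * (α + β + γ) < 7 * n * (α + β + γ)) :
    ∃ v, M < α * w v x + β * w v y + γ * w v z := by
  by_contra! hv
  have h1 : ∑ v, (α * w v x + β * w v y + γ * w v z) ≤ ∑ _v : Fin n, M :=
    Finset.sum_le_sum fun v _ => hv v
  simp only [Finset.sum_add_distrib, ← Finset.mul_sum, Finset.sum_const, Finset.card_univ,
    Fintype.card_fin, smul_eq_mul] at h1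
  have hx := h.deg x
  have hy := h.deg y
  have hz := h.deg z
  nlinarith

theorem not_555 (h : IsDense5 w) (x y z : Fin n) :
    ¬ (w x y = 5 ∧ w x z = 5 ∧ w y z = 5) := by
  rintro ⟨h1, h2, h3⟩
  obtain ⟨v, hv⟩ := h.exists_lt 1 1 1 10 x y z (by have := h.large; omega)
  have := h.quad x y z v
  have := h.le_five v x
  have := h.le_five v y
  have := h.le_five v z
  omega

theorem not_554 (h : IsDense5 w) (x y z : Fin n) :
    ¬ (w x y = 5 ∧ w x z = 5 ∧ w y z = 4) := by
  rintro ⟨h1, h2, h3⟩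
  obtain ⟨v, hv⟩ := h.exists_lt 13 10 10 113 x y z (by have := h.large; omega)
  have := h.quad x y z v
  have := h.le_five v x
  have := h.le_five v y
  have := h.le_five v z
  have := h.not_555 v x y
  have := h.not_555 v x z
  omega

theorem not_553 (h : IsDense5 w) (x y z : Fin n) :
    ¬ (w x y = 5 ∧ w x z = 5 ∧ w y z = 3) := by
  rintro ⟨h1, h2, h3⟩
  obtain ⟨v, hv⟩ := h.exists_lt 11 5 5 72 x y z (by have := h.large; omega)
  have := h.quad x y z v
  have := h.le_five v x
  have := h.le_five v y
  have := h.le_five v z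
  have := h.not_555 v x y
  have := h.not_555 v x z
  have := h.not_554 x v y
  have := h.not_554 y v x
  have := h.not_554 x v z
  have := h.not_554 z v x
  have := h.symm x v
  have := h.symm y v
  have := h.symm z v
  have := h.symm x y
  have := h.symm x z
  omega

theorem le_two_of_five_of_five (h : IsDense5 w) {x y z : Fin n} (hy : w x y = 5)
    (hz : w x z = 5) : w y z ≤ 2 := by
  have := h.le_five y z
  have := h.not_555 x y z
  have := h.not_554 x y z
  have := h.not_553 x y z
  omega

theorem not_544 (h : IsDense5 w) (x y z : Fin n) :
    ¬ (w x y = 5 ∧ w x z = 4 ∧ w y z = 4) := by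
  rintro ⟨h1, h2, h3⟩
  obtain ⟨v, hv⟩ := h.exists_lt 1 1 1 10 x y z (by have := h.large; omega)
  have := h.quad x y z v
  have := h.le_five v x
  have := h.le_five v y
  have := h.le_five v z
  have := @le_two_of_five_of_five _ _ h v y z
  have := @le_two_of_five_of_five _ _ h v x z
  have := @le_two_of_five_of_five _ _ h x v y
  have := @le_two_of_five_of_five _ _ h y v x
  have := h.symm x v
  have := h.symm y v
  have := h.symm x y
  omega

theorem add_le_seven (h : IsDense5 w) {x y : Fin n} (hxy : w x y = 5) (v : Fin n) :
    w v x + w v y ≤ 7 := by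
  have := h.le_five v x
  have := h.le_five v y
  have := h.not_544 x y v
  have := @le_two_of_five_of_five _ _ h x v y
  have := @le_two_of_five_of_five _ _ h y v x
  have := h.symm x v
  have := h.symm y v
  have := h.symm x y
  omega

theorem not_543 (h : IsDense5 w) (x y z : Fin n) :
    ¬ (w x y = 5 ∧ w x z = 4 ∧ w y z = 3) := by
  rintro ⟨h1, h2, h3⟩
  obtain ⟨v, hv⟩ := h.exists_lt 3 2 2 24 x y z (by have := h.large; omega)
  have := h.quad x y z v
  have := h.le_five v x
  have := h.le_five v y
  have := h.le_five v z
  have := h.add_le_seven h1 v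
  have := fun t => @add_le_seven _ _ h v x t z
  have := fun t => @add_le_seven _ _ h v y t z
  have := fun t => @add_le_seven _ _ h v z t x
  have := fun t => @add_le_seven _ _ h v z t y
  have := h.symm x v
  have := h.symm y v
  have := h.symm z v
  have := h.symm z x
  have := h.symm z y
  omega

theorem add_le_six_or (h : IsDense5 w) {x y : Fin n} (hxy : w x y = 5) (v : Fin n) :
    w v x + w v y ≤ 6 ∨ (w v x = 5 ∧ w v y = 2) ∨ (w v x = 2 ∧ w v y = 5) := by
  have := h.le_five v x
  have := h.le_five v y
  have := h.add_le_seven hxy v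
  have := h.not_543 x y v
  have := h.not_543 y x v
  have := h.symm x v
  have := h.symm y v
  have := h.symm x y
  omega

theorem exists_five (h : IsDense5 w) : ∃ x y, w x y = 5 := by
  by_contra! h5
  have h4 : ∀ u v, w u v ≤ 4 := fun u v => by
    have := h.le_five u v
    have := h5 u v
    omega
  have h444 : ∀ x y z, ¬ (w x y = 4 ∧ w x z = 4 ∧ w y z = 4) := by
    rintro x y z ⟨h1, h2, h3⟩
    obtain ⟨v, hv⟩ := h.exists_lt 1 1 1 10 x y z (by have := h.large; omega)
    have := h.quad x y z v
    have := h4 v x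
    have := h4 v y
    have := h4 v z
    omega
  have h443 : ∀ x y z, ¬ (w x y = 4 ∧ w x z = 4 ∧ w y z = 3) := by
    rintro x y z ⟨h1, h2, h3⟩
    obtain ⟨v, hv⟩ := h.exists_lt 1 1 1 10 x y z (by have := h.large; omega)
    have := h.quad x y z v
    have := h4 v x
    have := h4 v y
    have := h4 v z
    omega
  have h3 : ∀ x y, w x y ≤ 3 := by
    intro x y
    by_contra! hxy
    obtain ⟨v, hv⟩ := h.exists_lt 1 1 0 6 x y y (by have := h.large; omega)
    have := h4 x y
    have := h4 v x
    have := h4 v y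
    have := h444 x y v
    have := h443 x v y
    have := h443 y v x
    have := h.symm x y
    have := h.symm v y
    have := h.symm v x
    omega
  let x : Fin n := ⟨0, by have := h.large; omega⟩
  obtain ⟨v, hv⟩ := h.exists_lt 1 0 0 3 x x x (by have := h.large; omega)
  have := h3 v x
  omega

/-- The vertices joined to `a` with full multiplicity. -/
def full (w : Fin n → Fin n → ℕ) (a : Fin n) : Finset (Fin n) :=
  Finset.univ.filter fun v => w v a = 5

theorem card_full (h : IsDense5 w) {a b : Fin n} (hab : w a b = 5) :
    3 * n ≤ 6 * (full w a).card + 80 := by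
  have key : ∀ v, 3 * w v a + 2 * w v b ≤ 16 + 3 * (if w v a = 5 then 1 else 0) := by
    intro v
    have := h.le_five v a
    have := h.add_le_six_or hab v
    split_ifs <;> omega
  have hs := Finset.sum_le_sum fun v (_ : v ∈ Finset.univ) => key v
  have ha := h.deg a
  have hb := h.deg b
  rw [full, Finset.card_filter]
  simp only [Finset.sum_add_distrib, ← Finset.mul_sum, Finset.sum_const, Finset.card_univ,
    Fintype.card_fin, smul_eq_mul] at hs
  omega

theorem disjoint_full (h : IsDense5 w) {a b : Fin n} (hab : 3 ≤ w a b) :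
    Disjoint (full w a) (full w b) := by
  rw [Finset.disjoint_left]
  intro v hva hvb
  simp only [full, Finset.mem_filter_univ] at hva hvb
  have := h.le_two_of_five_of_five hva hvb
  omega

/-- A set of vertices to which `v` sends little forces the degree of `v` to be small. -/
theorem exists_mem_lt (h : IsDense5 w) (v : Fin n) (s : Finset (Fin n)) (r : ℕ)
    (h4 : ∀ u, w u v ≤ 4) (hr : r ≤ 4)
    (hs : n + 16 < 2 * (4 - r) * s.card) : ∃ u ∈ s, r < w u v := by
  by_contra! hu
  have key : ∀ u, w u v + (4 - r) * (if u ∈ s then 1 else 0) ≤ 4 := by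
    intro u
    have := h4 u
    split_ifs with hus
    · have := hu u hus
      omega
    · omega
  have hsum := Finset.sum_le_sum fun u (_ : u ∈ Finset.univ) => key u
  have hd := h.deg v
  simp only [Finset.sum_add_distrib, ← Finset.mul_sum, Finset.sum_const, Finset.card_univ,
    Fintype.card_fin, smul_eq_mul, Finset.sum_ite_mem, Finset.univ_inter] at hsum
  nlinarith

theorem exists_full (h : IsDense5 w) (v : Fin n) : ∃ u, w v u = 5 := by
  by_contra! h5
  have h4 : ∀ u, w u v ≤ 4 := fun u => by
    have := h.le_five u v
    have := h5 u
    have := h.symm u v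
    omega
  have hn := h.large
  obtain ⟨x, y, hxy⟩ := h.exists_five
  have hyx : w y x = 5 := by rw [h.symm, hxy]
  have hx := h.card_full hxy
  have hy := h.card_full hyx
  have hcard := Finset.card_union_of_disjoint (h.disjoint_full (a := x) (b := y) (by omega))
  obtain ⟨b, hb, hvb⟩ := h.exists_mem_lt v (full w x ∪ full w y) 3 h4 (by omega)
    (by omega)
  obtain ⟨c, hbc⟩ : ∃ c, w b c = 5 := by
    simp only [full, Finset.mem_union, Finset.mem_filter_univ] at hb
    exact hb.elim (fun hb => ⟨x, hb⟩) fun hb => ⟨y, hb⟩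
  have hbcard := h.card_full hbc
  obtain ⟨a, ha, hva⟩ := h.exists_mem_lt v (full w b) 2 h4 (by omega) (by omega)
  simp only [full, Finset.mem_filter_univ] at ha
  have := h.add_le_six_or ha v
  have := h.symm v a
  have := h.symm v b
  have := h4 a
  have := h4 b
  omega

theorem triangle_free (h : IsDense5 w) (x y z : Fin n) :
    ¬ (3 ≤ w x y ∧ 3 ≤ w x z ∧ 3 ≤ w y z) := by
  rintro ⟨hxy, hxz, hyz⟩
  obtain ⟨x', hx⟩ := h.exists_full x
  obtain ⟨y', hy⟩ := h.exists_full y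
  obtain ⟨z', hz⟩ := h.exists_full z
  have h1 := Finset.card_union_of_disjoint (h.disjoint_full hxy)
  have h2 := Finset.card_union_of_disjoint
    (Finset.disjoint_union_left.2 ⟨h.disjoint_full hxz, h.disjoint_full hyz⟩)
  have h3 := Finset.card_le_univ (full w x ∪ full w y ∪ full w z)
  have := h.card_full hx
  have := h.card_full hy
  have := h.card_full hz
  have := h.large
  simp only [Fintype.card_fin] at h3
  omega

theorem sum_le (h : IsDense5 w) (h0 : ∀ v, w v v = 0) :
    ∑ u, ∑ v, w u v ≤ 2 * (n * (n - 1)) + 6 * (n ^ 2 / 4) := by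
  let H : SimpleGraph (Fin n) :=
    { Adj := fun u v => 3 ≤ w u v
      symm := ⟨fun u v huv => by rwa [h.symm]⟩
      loopless := ⟨fun v hv => by simp [h0] at hv⟩ }
  have : DecidableRel H.Adj := fun u v => inferInstanceAs (Decidable (3 ≤ w u v))
  have hfree : H.CliqueFree (2 + 1) := by
    intro s hs
    obtain ⟨a, b, c, hab, hac, hbc, -⟩ := SimpleGraph.is3Clique_iff.1 hs
    exact h.triangle_free a b c ⟨hab, hac, hbc⟩
  have hcard : H.edgeFinset.card ≤ n ^ 2 / 4 := by
    have := hfree.card_edgeFinset_le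
    simp only [Fintype.card_fin] at this
    rcases Nat.mod_two_eq_zero_or_one n with h2 | h2 <;> simp [h2] at this <;> omega
  have hrow : ∀ u, ∑ v, w u v ≤ 2 * (n - 1) + 3 * H.degree u := by
    intro u
    have key : ∀ v, w u v ≤ (if v ≠ u then 2 else 0) + 3 * (if H.Adj u v then 1 else 0) := by
      intro v
      have := h.le_five u v
      have hadj : H.Adj u v ↔ 3 ≤ w u v := Iff.rfl
      rcases eq_or_ne v u with rfl | hv
      · simp [h0]
      · rw [if_pos hv]
        split_ifs <;> omega
    refine (Finset.sum_le_sum fun v _ => key v).trans ?_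
    rw [Finset.sum_add_distrib, ← Finset.mul_sum, ← Finset.card_filter, ← Finset.sum_filter,
      Finset.filter_ne', Finset.sum_const, Finset.card_erase_of_mem (Finset.mem_univ u),
      ← SimpleGraph.neighborFinset_eq_filter, SimpleGraph.card_neighborFinset_eq_degree]
    simp [mul_comm]
  calc ∑ u, ∑ v, w u v ≤ ∑ u, (2 * (n - 1) + 3 * H.degree u) :=
        Finset.sum_le_sum fun u _ => hrow u
    _ = n * (2 * (n - 1)) + 3 * (2 * H.edgeFinset.card) := by
        rw [Finset.sum_add_distrib, ← Finset.mul_sum _ _ 3, H.sum_degrees_eq_twice_card_edges]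
        simp
    _ ≤ _ := by rw [mul_left_comm]; omega

end IsDense5

theorem exists_mem_distinct {A B D : Finset (Fin 5)} (hA : 1 ≤ A.card) (hB : 2 ≤ B.card)
    (hD : 3 ≤ D.card) : ∃ i ∈ A, ∃ j ∈ B, ∃ k ∈ D, i ≠ j ∧ i ≠ k ∧ j ≠ k := by
  obtain ⟨i, hi⟩ := Finset.card_pos.1 hA
  obtain ⟨j, hj, hji⟩ := Finset.exists_mem_ne hB i
  obtain ⟨k, hk, hk'⟩ := Finset.exists_mem_notMem_of_card_lt_card
    (s := {i, j}) (t := D) (lt_of_le_of_lt Finset.card_le_two hD)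
  simp only [Finset.mem_insert, Finset.mem_singleton, not_or] at hk'
  exact ⟨i, hi, j, hj, k, hk, hji.symm, Ne.symm hk'.1, Ne.symm hk'.2⟩

theorem add_card_le_card_inter_add_five (A B : Finset (Fin 5)) :
    A.card + B.card ≤ (A ∩ B).card + 5 := by
  have h1 := Finset.card_union_add_card_inter A B
  have h2 := Finset.card_le_univ (A ∪ B)
  rw [Fintype.card_fin] at h2
  omega

/-- A `𝕂₄`-free 5-multigraph, described by the set of colours on each pair of vertices. -/
structure IsFreeColoring {n : ℕ} (C : Fin n → Fin n → Finset (Fin 5)) : Prop where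
  symm : ∀ u v, C u v = C v u
  irrefl : ∀ v, C v v = ∅
  free : ∀ a b c d : Fin n, ∀ i ∈ C a b ∩ C c d, ∀ j ∈ C a c ∩ C b d, ∀ k ∈ C a d ∩ C b c,
    i ≠ j → i ≠ k → j ≠ k → False

namespace IsFreeColoring

variable {n : ℕ} {C : Fin n → Fin n → Finset (Fin 5)}

theorem quad (h : IsFreeColoring C) (x y z v : Fin n) :
    (C v x).card + (C y z).card ≤ 5 ∨ (C v y).card + (C x z).card ≤ 5 ∨
    (C v z).card + (C x y).card ≤ 5 ∨
    ((C v x).card + (C y z).card ≤ 6 ∧ (C v y).card + (C x z).card ≤ 6) ∨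
    ((C v x).card + (C y z).card ≤ 6 ∧ (C v z).card + (C x y).card ≤ 6) ∨
    ((C v y).card + (C x z).card ≤ 6 ∧ (C v z).card + (C x y).card ≤ 6) ∨
    ((C v x).card + (C y z).card ≤ 7 ∧ (C v y).card + (C x z).card ≤ 7 ∧
      (C v z).card + (C x y).card ≤ 7) := by
  have hx := add_card_le_card_inter_add_five (C v x) (C y z)
  have hy := add_card_le_card_inter_add_five (C v y) (C x z)
  have hz := add_card_le_card_inter_add_five (C v z) (C x y)
  have hfree := h.free v x y z
  generalize C v x ∩ C y z = A at hx hfree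
  generalize C v y ∩ C x z = B at hy hfree
  generalize C v z ∩ C x y = D at hz hfree
  have h1 : ¬ (1 ≤ A.card ∧ 2 ≤ B.card ∧ 3 ≤ D.card) := fun ⟨ha, hb, hd⟩ => by
    obtain ⟨i, hi, j, hj, k, hk, h1, h2, h3⟩ := exists_mem_distinct ha hb hd
    exact hfree i hi j hj k hk h1 h2 h3
  have h2 : ¬ (1 ≤ A.card ∧ 2 ≤ D.card ∧ 3 ≤ B.card) := fun ⟨ha, hd, hb⟩ => by
    obtain ⟨i, hi, k, hk, j, hj, h1, h2, h3⟩ := exists_mem_distinct ha hd hb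
    exact hfree i hi j hj k hk h2 h1 h3.symm
  have h3 : ¬ (1 ≤ B.card ∧ 2 ≤ A.card ∧ 3 ≤ D.card) := fun ⟨hb, ha, hd⟩ => by
    obtain ⟨j, hj, i, hi, k, hk, h1, h2, h3⟩ := exists_mem_distinct hb ha hd
    exact hfree i hi j hj k hk h1.symm h3 h2
  have h4 : ¬ (1 ≤ B.card ∧ 2 ≤ D.card ∧ 3 ≤ A.card) := fun ⟨hb, hd, ha⟩ => by
    obtain ⟨j, hj, k, hk, i, hi, h1, h2, h3⟩ := exists_mem_distinct hb hd ha
    exact hfree i hi j hj k hk h2.symm h3.symm h1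
  have h5 : ¬ (1 ≤ D.card ∧ 2 ≤ A.card ∧ 3 ≤ B.card) := fun ⟨hd, ha, hb⟩ => by
    obtain ⟨k, hk, i, hi, j, hj, h1, h2, h3⟩ := exists_mem_distinct hd ha hb
    exact hfree i hi j hj k hk h3 h1.symm h2.symm
  have h6 : ¬ (1 ≤ D.card ∧ 2 ≤ B.card ∧ 3 ≤ A.card) := fun ⟨hd, hb, ha⟩ => by
    obtain ⟨k, hk, j, hj, i, hi, h1, h2, h3⟩ := exists_mem_distinct hd hb ha
    exact hfree i hi j hj k hk h3.symm h2.symm h1.symm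
  omega

theorem comp (h : IsFreeColoring C) (φ : Fin n → Fin n) :
    IsFreeColoring fun a b => C (φ a) (φ b) :=
  ⟨fun _ _ => h.symm _ _, fun _ => h.irrefl _, fun _ _ _ _ => h.free _ _ _ _⟩

end IsFreeColoring

theorem sum_comp_update_id {n : ℕ} (g : Fin n → ℕ) (u v : Fin n) :
    ∑ a, g (Function.update id u v a) + g u = ∑ a, g a + g v := by
  have h1 : (fun a => g (Function.update id u v a)) = Function.update g u (g v) := by
    ext a
    rcases eq_or_ne a u with rfl | ha
    · simp
    · simp [ha]
  rw [h1, Finset.sum_update_of_mem (Finset.mem_univ u),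
    ← Finset.sum_sdiff (Finset.subset_univ {u}) (f := g), Finset.sum_singleton]
  ring

/-- Replacing `u` by a copy of `v`. -/
theorem sum_sum_comp_update_id {n : ℕ} (w : Fin n → Fin n → ℕ) (hs : ∀ a b, w a b = w b a)
    (h0 : ∀ a, w a a = 0) (u v : Fin n) :
    ∑ a, ∑ b, w (Function.update id u v a) (Function.update id u v b) + 2 * ∑ a, w a u + 2 * w u v
      = ∑ a, ∑ b, w a b + 2 * ∑ a, w a v := by
  have h1 := sum_comp_update_id (fun a => ∑ b, w a (Function.update id u v b)) u v
  have h2 := fun a => sum_comp_update_id (w a) u v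
  have h3 := Finset.sum_congr rfl fun a (_ : a ∈ Finset.univ) => h2 a
  have hu := h2 u
  have hv := h2 v
  simp only [Finset.sum_add_distrib] at h3
  rw [h0 u, Finset.sum_congr rfl fun a _ => hs u a] at hu
  rw [h0 v, hs v u, Finset.sum_congr rfl fun a _ => hs v a] at hv
  omega

/-- A maximum `𝕂₄`-free colouring has almost equal degrees, as one vertex may be replaced by a
copy of another, so the bound for dense weights applies. -/
theorem IsFreeColoring.sum_card_le {n : ℕ} (hn : 632 ≤ n) {C : Fin n → Fin n → Finset (Fin 5)}
    (h : IsFreeColoring C)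
    (hmax : ∀ C' : Fin n → Fin n → Finset (Fin 5), IsFreeColoring C' →
      ∑ u, ∑ v, (C' u v).card ≤ ∑ u, ∑ v, (C u v).card) :
    ∑ u, ∑ v, (C u v).card ≤ 2 * (n * (n - 1)) + 6 * (n ^ 2 / 4) := by
  by_contra! hlt
  refine hlt.not_ge (IsDense5.sum_le (w := fun u v => (C u v).card)
    ⟨fun u v => by rw [h.symm], fun u v => by simpa using Finset.card_le_univ (C u v),
      h.quad, hn, fun u => ?_⟩ fun v => by simp [h.irrefl])
  obtain ⟨v, hv⟩ : ∃ v, 7 * n ≤ 2 * ∑ a, (C a v).card + 6 := by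
    by_contra! hv
    have hs := Finset.sum_le_sum fun v (_ : v ∈ Finset.univ) => (hv v).le
    rw [Finset.sum_comm] at hlt
    simp only [Finset.sum_add_distrib, ← Finset.mul_sum, Finset.sum_const, Finset.card_univ,
      Fintype.card_fin, smul_eq_mul] at hs
    obtain ⟨m, rfl⟩ : ∃ m, n = m + 1 := ⟨n - 1, by omega⟩
    have hdiv : (m + 1) ^ 2 ≤ 4 * ((m + 1) ^ 2 / 4) + 3 := by omega
    rw [Nat.add_sub_cancel] at hlt
    nlinarith
  have hcopy := sum_sum_comp_update_id (fun a b => (C a b).card) (fun a b => by rw [h.symm])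
    (fun a => by simp [h.irrefl]) u v
  have hle := hmax _ (h.comp (Function.update id u v))
  have h5 : (C u v).card ≤ 5 := by simpa using Finset.card_le_univ (C u v)
  omega

/-- The colours on each pair of vertices of a 5-multigraph. -/
def coloring {n : ℕ} (G : Fin 5 → Finset (Finset (Fin n))) (u v : Fin n) : Finset (Fin 5) :=
  Finset.univ.filter fun i => ({u, v} : Finset (Fin n)) ∈ G i

open Classical in
/-- The 5-multigraph with prescribed colours on each pair of vertices. -/
noncomputable def ofColoring {n : ℕ} (C : Fin n → Fin n → Finset (Fin 5)) (i : Fin 5) :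
    Finset (Finset (Fin n)) :=
  Finset.univ.filter fun e => ∃ u v, e = {u, v} ∧ i ∈ C u v

theorem isFreeColoring_coloring {n : ℕ} {G : Fin 5 → Finset (Finset (Fin n))} (hG : IsMulti5 G)
    (hfree : ¬ ContainsK4 G) : IsFreeColoring (coloring G) := by
  have hne : ∀ i u v, ({u, v} : Finset (Fin n)) ∈ G i → u ≠ v := by
    rintro i u v h rfl
    simpa using hG i _ h
  refine ⟨fun u v => by simp only [coloring, Finset.pair_comm], fun v => ?_, ?_⟩
  · ext i
    simpa [coloring] using fun h => hne i v v (by simpa using h) rfl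
  · intro a b c d i hi j hj k hk hij hik hjk
    simp only [coloring, Finset.mem_inter, Finset.mem_filter_univ] at hi hj hk
    exact hfree ⟨i, j, k, a, b, c, d, hij, hik, hjk, hne _ _ _ hi.1, hne _ _ _ hj.1,
      hne _ _ _ hk.1, hne _ _ _ hk.2, hne _ _ _ hj.2, hne _ _ _ hi.2, hi.1, hi.2, hj.1, hj.2,
      hk.1, hk.2⟩

theorem mem_ofColoring {n : ℕ} {C : Fin n → Fin n → Finset (Fin 5)} (h : ∀ u v, C u v = C v u)
    {i : Fin 5} {u v : Fin n} : ({u, v} : Finset (Fin n)) ∈ ofColoring C i ↔ i ∈ C u v := by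
  simp only [ofColoring, Finset.mem_filter_univ]
  refine ⟨?_, fun hi => ⟨u, v, rfl, hi⟩⟩
  rintro ⟨a, b, hab, hi⟩
  rw [← Finset.coe_inj, Finset.coe_pair, Finset.coe_pair, Set.pair_eq_pair_iff] at hab
  rcases hab with ⟨rfl, rfl⟩ | ⟨rfl, rfl⟩
  · exact hi
  · rwa [h]

theorem coloring_ofColoring {n : ℕ} {C : Fin n → Fin n → Finset (Fin 5)}
    (h : ∀ u v, C u v = C v u) : coloring (ofColoring C) = C := by
  ext u v i
  simp [coloring, mem_ofColoring h]

theorem IsFreeColoring.isMulti5 {n : ℕ} {C : Fin n → Fin n → Finset (Fin 5)}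
    (h : IsFreeColoring C) : IsMulti5 (ofColoring C) := by
  intro i e he
  simp only [ofColoring, Finset.mem_filter_univ] at he
  obtain ⟨u, v, rfl, hi⟩ := he
  refine Finset.card_pair ?_
  rintro rfl
  simp [h.irrefl] at hi

theorem IsFreeColoring.not_containsK4 {n : ℕ} {C : Fin n → Fin n → Finset (Fin 5)}
    (h : IsFreeColoring C) : ¬ ContainsK4 (ofColoring C) := by
  rintro ⟨i, j, k, a, b, c, d, hij, hik, hjk, -, -, -, -, -, -, hK⟩
  simp only [mem_ofColoring h.symm] at hK
  obtain ⟨h1, h2, h3, h4, h5, h6⟩ := hK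
  exact h.free a b c d i (Finset.mem_inter.2 ⟨h1, h2⟩) j (Finset.mem_inter.2 ⟨h3, h4⟩) k
    (Finset.mem_inter.2 ⟨h5, h6⟩) hij hik hjk

theorem two_mul_msize {n : ℕ} {G : Fin 5 → Finset (Finset (Fin n))} (hG : IsMulti5 G) :
    2 * msize G = ∑ u, ∑ v, (coloring G u v).card := by
  have hi : ∀ i, ∑ u, ∑ v, (if ({u, v} : Finset (Fin n)) ∈ G i then 1 else 0)
      = 2 * (G i).card := by
    intro i
    rw [← Finset.sum_product', ← Finset.card_filter, mul_comm,
      Finset.card_eq_sum_card_fiberwise (f := fun p : Fin n × Fin n => ({p.1, p.2} : Finset _))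
        (t := G i) fun p hp => by simpa using hp]
    refine Finset.sum_const_nat fun e he => ?_
    obtain ⟨a, b, hab, rfl⟩ := Finset.card_eq_two.1 (hG i e he)
    have hne : (a, b) ≠ (b, a) := fun h => hab (congrArg Prod.fst h)
    rw [← Finset.card_pair hne]
    congr 1
    ext ⟨u, v⟩
    simp only [Finset.mem_filter, Finset.mem_product, Finset.mem_univ, true_and,
      Finset.mem_insert, Finset.mem_singleton, Prod.mk.injEq]
    rw [← Set.pair_eq_pair_iff, ← Finset.coe_pair, ← Finset.coe_pair, Finset.coe_inj]
    exact ⟨fun h => h.2, fun h => ⟨h ▸ he, h⟩⟩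
  simp only [coloring, Finset.card_filter]
  rw [msize, Finset.mul_sum, ← Finset.sum_congr rfl fun i _ => hi i, Finset.sum_comm]
  exact Finset.sum_congr rfl fun u _ => Finset.sum_comm

/-- The colours available between two vertices of a balanced bipartition: all of them across,
and two disjoint pairs inside the two classes. -/
def palette : Bool → Bool → Finset (Fin 5)
  | true, true => {0, 1}
  | false, false => {2, 3}
  | _, _ => Finset.univ

theorem palette_free : ∀ a b c d : Bool, ∀ i ∈ palette a b ∩ palette c d,
    ∀ j ∈ palette a c ∩ palette b d, ∀ k ∈ palette a d ∩ palette b c,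
    i ≠ j → i ≠ k → j ≠ k → False := by
  decide

theorem exists_isFreeColoring (n : ℕ) : ∃ C : Fin n → Fin n → Finset (Fin 5),
    IsFreeColoring C ∧
      ∑ u, ∑ v, (C u v).card = 2 * (n * (n - 1)) + 6 * (n ^ 2 / 4) := by
  let s : Fin n → Bool := fun v => decide (v.val < n / 2)
  refine ⟨fun u v => if u = v then ∅ else palette (s u) (s v), ⟨?_, ?_, ?_⟩, ?_⟩
  · intro u v
    have : ∀ a b, palette a b = palette b a := by decide
    simp only [eq_comm, this (s u)]
  · simp
  · intro a b c d i hi j hj k hk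
    have hsub : ∀ u v, (if u = v then ∅ else palette (s u) (s v)) ⊆ palette (s u) (s v) := by
      intro u v
      split_ifs <;> simp
    exact palette_free _ _ _ _ i (Finset.inter_subset_inter (hsub _ _) (hsub _ _) hi)
      j (Finset.inter_subset_inter (hsub _ _) (hsub _ _) hj)
      k (Finset.inter_subset_inter (hsub _ _) (hsub _ _) hk)
  · have hcard : ∀ u v, (if u = v then ∅ else palette (s u) (s v)).card =
        (if v ≠ u then 2 else 0) + 3 * (if s v = !s u then 1 else 0) := by
      intro u v
      have hp : ∀ a b, (palette a b).card = 2 + 3 * (if b = !a then 1 else 0) := by decide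
      rcases eq_or_ne u v with rfl | huv
      · simp
      · rw [if_neg huv, if_pos huv.symm, hp]
    have htrue : (Finset.univ.filter fun v => s v = true).card = n / 2 := by
      simp only [s, decide_eq_true_eq]
      rw [Fin.card_filter_val_lt]
      omega
    have hfalse : (Finset.univ.filter fun v => s v = false).card = n - n / 2 := by
      have := Finset.card_filter_add_card_filter_not (s := (Finset.univ : Finset (Fin n)))
        (fun v => s v = true)
      simp only [Bool.not_eq_true, Finset.card_univ, Fintype.card_fin] at this
      omega
    have hrow : ∀ u, ∑ v, (if u = v then ∅ else palette (s u) (s v)).card =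
        2 * (n - 1) + 3 * ((if s u = true then n - n / 2 else 0) +
          if s u = false then n / 2 else 0) := by
      intro u
      simp only [hcard]
      rw [Finset.sum_add_distrib, ← Finset.mul_sum, ← Finset.card_filter, ← Finset.sum_filter,
        Finset.filter_ne', Finset.sum_const, Finset.card_erase_of_mem (Finset.mem_univ u)]
      rcases s u <;> simp [htrue, hfalse, mul_comm]
    simp only [hrow]
    rw [Finset.sum_add_distrib, ← Finset.mul_sum _ _ 3, Finset.sum_add_distrib, ← Finset.sum_filter,
      ← Finset.sum_filter, Finset.sum_const, Finset.sum_const, Finset.sum_const, htrue, hfalse]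
    simp only [Finset.card_univ, Fintype.card_fin, smul_eq_mul]
    have hsq : n ^ 2 / 4 = n / 2 * (n - n / 2) := by
      rcases Nat.even_or_odd' n with ⟨m, rfl | rfl⟩
      · rw [Nat.mul_div_cancel_left m two_pos, show 2 * m - m = m by omega,
          show (2 * m) ^ 2 = 4 * (m * m) by ring, Nat.mul_div_cancel_left _ four_pos]
      · rw [show (2 * m + 1) / 2 = m by omega, show 2 * m + 1 - m = m + 1 by omega,
          show (2 * m + 1) ^ 2 = 4 * (m * (m + 1)) + 1 by ring]
        omega
    rw [hsq]
    ring

/-- For every n ≥ 632, `ex₅(n, 𝕂₄) = 2·C(n,2) + 3·⌊n²/4⌋`. -/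
theorem ex5K4_value (n : ℕ) (hn : 632 ≤ n) :
    ex5K4 n = 2 * Nat.choose n 2 + 3 * (n ^ 2 / 4) := by
  have hchoose : n * (n - 1) = 2 * n.choose 2 := by
    rw [Nat.choose_two_right, Nat.mul_div_cancel' (Nat.even_mul_pred_self n).two_dvd]
  obtain ⟨C, hC, hmax⟩ := Set.exists_max_image
    {C : Fin n → Fin n → Finset (Fin 5) | IsFreeColoring C} (fun C => ∑ u, ∑ v, (C u v).card)
    (Set.toFinite _) ((exists_isFreeColoring n).imp fun _ h => h.1)
  have hle := IsFreeColoring.sum_card_le hn hC hmax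
  refine IsGreatest.csSup_eq ⟨?_, ?_⟩
  · obtain ⟨C₀, hC₀, hsum⟩ := exists_isFreeColoring n
    refine ⟨ofColoring C₀, hC₀.isMulti5, hC₀.not_containsK4, ?_⟩
    have := two_mul_msize hC₀.isMulti5
    rw [coloring_ofColoring hC₀.symm] at this
    omega
  · rintro m ⟨G, hG, hfree, rfl⟩
    have := hmax _ (isFreeColoring_coloring hG hfree)
    have := two_mul_msize hG
    omega
end
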